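/- arXiv:2207.13951 — 2 statements merged into one kernel-verified Lean document; each statement's English description precedes it below -/
import Mathlib

section
/- Let (V,T) be a non-degenerate cubic space over k and let (W,S) be a cubic space over k with dim_k W ≤ ℵ₀. Then there exists an embedding of cubic spaces W → V if and only if rrk(W,S) ≤ rrk(V,T). -/
open scoped BigOperators

/-- The submodule of quadratic forms of finite strength: those expressible as a finite
sum of products of two linear forms. -/
def FinStrength (k V : Type*) [Field k] [AddCommGroup V] [Module k V] :
    Submodule k (QuadraticForm k V) where
  carrier := {q | ∃ (n : ℕ) (l m : Fin n → V →ₗ[k] k), ∀ x, q x = ∑ i, l i x * m i x}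
  zero_mem' := ⟨0, ![], ![], fun x => by simp⟩
  add_mem' := by
    rintro q q' ⟨n, l, m, h⟩ ⟨n', l', m', h'⟩
    refine ⟨n + n', Fin.append l l', Fin.append m m', fun x => ?_⟩
    simp [Fin.sum_univ_add, Fin.append_left, Fin.append_right, h, h']
  smul_mem' := by
    rintro c q ⟨n, l, m, h⟩
    refine ⟨n, fun i => c • l i, m, fun x => ?_⟩
    simp [h, Finset.mul_sum, mul_assoc, smul_eq_mul]

/-- For a trilinear form `T` and a vector `v`, the quadratic form `f_v : x ↦ 3 * T v x x`. -/
noncomputable def fQuad {k V : Type*} [Field k] [AddCommGroup V] [Module k V]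
    (T : V →ₗ[k] V →ₗ[k] V →ₗ[k] k) (v : V) : QuadraticForm k V :=
  LinearMap.BilinMap.toQuadraticMap ((3 : k) • T v)

/-- The residual rank of a trilinear form `T`: the dimension of the image of the linear
map `v ↦ class of f_v` in the quotient of the space of quadratic forms by the subspace
of finite-strength quadratic forms. -/
noncomputable def rrk (k : Type*) {V : Type*} [Field k] [AddCommGroup V] [Module k V]
    (T : V →ₗ[k] V →ₗ[k] V →ₗ[k] k) : Cardinal :=
  Module.rank k ↥(Submodule.span k
    (Set.range fun v => Submodule.Quotient.mk (p := FinStrength k V) (fQuad T v)))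

/-- A cubic space `(V,T)` has finite strength if its cubic form `x ↦ T x x x` is a
finite sum of products of a linear form with a quadratic form. -/
def FiniteStrengthCubic (k : Type*) {V : Type*} [Field k] [AddCommGroup V] [Module k V]
    (T : V →ₗ[k] V →ₗ[k] V →ₗ[k] k) : Prop :=
  ∃ (n : ℕ) (l : Fin n → V →ₗ[k] k) (q : Fin n → QuadraticForm k V),
    ∀ x, T x x x = ∑ i, l i x * q i x

universe u v w

section Helpers

variable {k : Type*} {V : Type*} [Field k] [AddCommGroup V] [Module k V]

/-- The linear map `v ↦ class of f_v`. -/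
noncomputable def fLin (T : V →ₗ[k] V →ₗ[k] V →ₗ[k] k) :
    V →ₗ[k] (QuadraticForm k V ⧸ FinStrength k V) :=
  (FinStrength k V).mkQ ∘ₗ
    { toFun := fQuad T
      map_add' := by intro x y; ext z; simp [fQuad, mul_add]
      map_smul' := by intro c y; ext z; simp [fQuad, mul_left_comm] }

/-- The kernel: vectors whose quadratic form has finite strength. -/
noncomputable def KK (T : V →ₗ[k] V →ₗ[k] V →ₗ[k] k) : Submodule k V := LinearMap.ker (fLin T)

lemma mem_KK (T : V →ₗ[k] V →ₗ[k] V →ₗ[k] k) (v : V) :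
    v ∈ KK T ↔ ∃ (n : ℕ) (l m : Fin n → V →ₗ[k] k), ∀ x, 3 * T v x x = ∑ i, l i x * m i x := by
  have : v ∈ KK T ↔ fQuad T v ∈ FinStrength k V := by
    simp [KK, fLin]
  rw [this]
  constructor
  · rintro ⟨n, l, m, h⟩
    exact ⟨n, l, m, fun x => by rw [← h x]; simp [fQuad]⟩
  · rintro ⟨n, l, m, h⟩
    exact ⟨n, l, m, fun x => by rw [← h x]; simp [fQuad]⟩

lemma rrk_eq.{u₁, v₁} {k : Type u₁} {V : Type v₁} [Field k] [AddCommGroup V] [Module k V]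
    (T : V →ₗ[k] V →ₗ[k] V →ₗ[k] k) :
    rrk k T = Cardinal.lift.{u₁} (Module.rank k (V ⧸ KK T)) := by
  have h := (fLin T).quotKerEquivRange.lift_rank_eq
  have h2 : Submodule.span k
      (Set.range fun v => Submodule.Quotient.mk (p := FinStrength k V) (fQuad T v))
      = LinearMap.range (fLin T) := by
    have : (Set.range fun v => Submodule.Quotient.mk (p := FinStrength k V) (fQuad T v))
      = ((LinearMap.range (fLin T) : Submodule k _) : Set _) := by
      ext; simp [fLin]
    rw [this, Submodule.span_eq]
  unfold rrk KK
  rw [h2]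
  have h3 : Cardinal.lift.{v₁} (Module.rank k (LinearMap.range (fLin T))) =
    Module.rank k (LinearMap.range (fLin T)) := Cardinal.lift_id'.{v₁, max u₁ v₁} _
  rw [← h3, ← h]
  exact (Cardinal.lift_umax.{v₁, u₁}).symm ▸ rfl

/-- finite codimension -/
def FC (U : Submodule k V) : Prop := Module.Finite k (V ⧸ U)

lemma FC.mono {U U' : Submodule k V} (h : FC U) (hU : U ≤ U') : FC U' := by
  unfold FC at *
  exact Module.Finite.of_surjective (Submodule.factor hU) (Submodule.factor_surjective hU)

lemma FC.ker {E : Type*} [AddCommGroup E] [Module k E] [Module.Finite k E] (f : V →ₗ[k] E) :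
    FC (LinearMap.ker f) := by
  unfold FC
  exact Module.Finite.equiv f.quotKerEquivRange.symm

lemma FC.inf {U U' : Submodule k V} (h : FC U) (h' : FC U') : FC (U ⊓ U') := by
  have h1 : Module.Finite k (V ⧸ U) := h
  have h2 : Module.Finite k (V ⧸ U') := h'
  have := FC.ker (U.mkQ.prod U'.mkQ)
  simpa [LinearMap.ker_prod] using this

lemma FC.top : FC (⊤ : Submodule k V) := by
  have := FC.ker (0 : V →ₗ[k] k)
  simpa using this

lemma FC.exists_proj {U : Submodule k V} (h : FC U) :
    ∃ (n : ℕ) (l : Fin n → V →ₗ[k] k) (c : Fin n → V) (π : V →ₗ[k] V),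
      (∀ x, π x ∈ U) ∧ ∀ x, x = π x + ∑ i, l i x • c i := by
  have h1 : Module.Finite k (V ⧸ U) := h
  let b := Module.finBasis k (V ⧸ U)
  obtain ⟨s, hs⟩ := U.mkQ.exists_rightInverse_of_surjective (by simp)
  refine ⟨_, fun i => b.coord i ∘ₗ U.mkQ, fun i => s (b i),
    LinearMap.id - s ∘ₗ U.mkQ, fun x => ?_, fun x => ?_⟩
  · refine (Submodule.Quotient.mk_eq_zero U).1 ?_
    rw [← Submodule.mkQ_apply]
    have := LinearMap.congr_fun hs (U.mkQ x)
    simp only [LinearMap.comp_apply, LinearMap.id_apply] at this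
    simp only [LinearMap.sub_apply, LinearMap.comp_apply, LinearMap.id_apply, map_sub, this, sub_self]
  · have := b.sum_repr (U.mkQ x)
    have h2 := congrArg s this
    simp only [map_sum, map_smul] at h2
    simp only [LinearMap.sub_apply, LinearMap.comp_apply, LinearMap.id_apply, Module.Basis.coord_apply]
    rw [h2]; simp

lemma FC.biInf {ι : Type*} (s : Finset ι) (f : ι → Submodule k V) (h : ∀ i ∈ s, FC (f i)) :
    FC (⨅ i ∈ s, f i) := by
  classical
  induction s using Finset.induction_on with
  | empty => simpa using FC.top
  | insert a s ha ih =>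
    rw [Finset.iInf_insert]
    exact FC.inf (h _ (by simp)) (ih fun i hi => h i (by simp [hi]))

/-- If `T v x x` vanishes on a finite-codimensional subspace then `v ∈ KK T`. -/
lemma exists_quad_ne (T : V →ₗ[k] V →ₗ[k] V →ₗ[k] k) (v : V) (hv : v ∉ KK T)
    {U : Submodule k V} (hU : FC U) : ∃ x ∈ U, T v x x ≠ 0 := by
  by_contra! hc
  obtain ⟨n, l, c, π, hπ, hx⟩ := hU.exists_proj
  apply hv
  rw [mem_KK]
  refine ⟨n, l, fun i => (3 : k) • (T v (c i) + (T v).flip (c i) ∘ₗ π), fun x => ?_⟩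
  have h1 : T v x x = T v (π x) (π x) + T v (x - π x) x + T v (π x) (x - π x) := by
    simp only [map_sub, LinearMap.sub_apply]; ring
  have h2 : x - π x = ∑ i, l i x • c i := by
    rw [sub_eq_iff_eq_add, add_comm]; exact hx x
  rw [h1, hc _ (hπ x), h2]
  simp only [map_sum, LinearMap.sum_apply, map_smul, LinearMap.smul_apply, smul_eq_mul,
    LinearMap.add_apply, LinearMap.comp_apply, LinearMap.flip_apply, zero_add,
    ← Finset.sum_add_distrib, Finset.mul_sum]
  refine Finset.sum_congr rfl fun i _ => ?_
  ring

lemma exists_cubic_ne (T : V →ₗ[k] V →ₗ[k] V →ₗ[k] k)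
    (hT1 : ∀ x y z, T x y z = T y x z) (hT2 : ∀ x y z, T x y z = T x z y) (hT : ¬ FiniteStrengthCubic k T)
    {U : Submodule k V} (hU : FC U) : ∃ x ∈ U, T x x x ≠ 0 := by
  by_contra! hc
  obtain ⟨n, l, c, π, hπ, hx⟩ := hU.exists_proj
  apply hT
  refine ⟨n, l, fun i => LinearMap.BilinMap.toQuadraticMap
    (T (c i) + (T (c i)) ∘ₗ π + (T (c i)).compl₁₂ π π),
    fun x => ?_⟩
  have h1 : T x x x = T (π x) (π x) (π x) + T (x - π x) x x + T (π x) (x - π x) x +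
      T (π x) (π x) (x - π x) := by
    simp only [map_sub, LinearMap.sub_apply]; ring
  have h2 : x - π x = ∑ i, l i x • c i := by
    rw [sub_eq_iff_eq_add, add_comm]; exact hx x
  rw [h1, hc _ (hπ x), h2]
  simp only [map_sum, LinearMap.sum_apply, map_smul, LinearMap.smul_apply, smul_eq_mul,
    LinearMap.add_apply, LinearMap.comp_apply, LinearMap.flip_apply, zero_add,
    ← Finset.sum_add_distrib, LinearMap.BilinMap.toQuadraticMap_apply, LinearMap.compl₁₂_apply]
  refine Finset.sum_congr rfl fun i _ => ?_
  rw [hT1 (π x) (c i) x, hT2 (π x) (π x) (c i), hT1 (π x) (c i) (π x)]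
  ring

/-- For `v ∈ KK T` the radical has finite codimension. -/
lemma FC_rad (hk2 : (2 : k) ≠ 0) (hk3 : (3 : k) ≠ 0) (T : V →ₗ[k] V →ₗ[k] V →ₗ[k] k)
    (hT2 : ∀ x y z, T x y z = T x z y) {v : V} (hv : v ∈ KK T) :
    FC (LinearMap.ker (T v)) := by
  rw [mem_KK] at hv
  obtain ⟨n, l, m, h⟩ := hv
  refine (FC.inf (FC.ker (LinearMap.pi l)) (FC.ker (LinearMap.pi m))).mono ?_
  rintro x ⟨hl, hm⟩
  have hl' : ∀ i, l i x = 0 := fun i => by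
    simpa using congrFun (LinearMap.mem_ker.1 hl) i
  have hm' : ∀ i, m i x = 0 := fun i => by
    simpa using congrFun (LinearMap.mem_ker.1 hm) i
  rw [LinearMap.mem_ker]
  ext y
  have h1 := h (x + y)
  have h2 := h x
  have h3 := h y
  simp only [map_add, LinearMap.add_apply, hl', hm', zero_add, mul_zero, Finset.sum_const_zero] at h1 h2
  rw [← h3, hT2 v y x] at h1
  have : (2 * 3 : k) * T v x y = 0 := by linear_combination h1 - h2
  simpa [hk2, hk3] using this

end Helpers

section Solve

lemma seq_exists {V : Type*} [Inhabited V] (Step : ℕ → (ℕ → V) → V → Prop)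
    (hc : ∀ n f g v, (∀ i < n, f i = g i) → Step n f v → Step n g v)
    (h : ∀ n f, (∀ m < n, Step m f (f m)) → ∃ v, Step n f v) :
    ∃ f : ℕ → V, ∀ n, Step n f (f n) := by
  classical
  let G : ℕ → (ℕ → V) → V := fun n f => if h : ∃ v, Step n f v then h.choose else default
  have hG : ∀ n f, (∃ v, Step n f v) → Step n f (G n f) := by
    intro n f h
    simp only [G, dif_pos h]
    exact h.choose_spec
  let F : ℕ → V := fun n => Nat.strongRec (motive := fun _ => V)
    (fun n ih => G n (fun i => if hi : i < n then ih i hi else default)) n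
  have hF : ∀ n, F n = G n (fun i => if i < n then F i else default) := by
    intro n
    simp only [F]
    rw [Nat.strongRec_eq]
    simp
  refine ⟨F, fun n => ?_⟩
  induction n using Nat.strong_induction_on with
  | _ n ih =>
    rw [hF n]
    refine hc n _ _ _ (fun i hi => if_pos hi) (hG n _ ?_)
    obtain ⟨v, hv⟩ := h n F ih
    exact ⟨v, hc n _ _ _ (fun i hi => (if_pos hi).symm) hv⟩

variable {k : Type*} {V : Type*} [Field k] [AddCommGroup V] [Module k V]

lemma quad_solve [IsAlgClosed k] {E : Type*} [AddCommGroup E] [Module k E] [Module.Finite k E]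
    (B : V →ₗ[k] V →ₗ[k] E) (hB : ∀ x y, B x y = B y x)
    (H : ∀ f : E →ₗ[k] k, f ≠ 0 → ∀ U : Submodule k V, FC U → ∃ x ∈ U, f (B x x) ≠ 0)
    {U : Submodule k V} (hU : FC U) (t : E) : ∃ v ∈ U, B v v = t := by
  let Good : Submodule k E → Prop := fun L => ∃ U' : Submodule k V, FC U' ∧ U' ≤ U ∧
    ∀ t ∈ L, ∃ v ∈ U, B v v = t ∧ ∀ y ∈ U', B v y = 0
  obtain ⟨L, hL, hmax⟩ := (wellFounded_gt (α := Submodule k E)).has_min {L | Good L}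
    ⟨⊥, U, hU, le_rfl, by
      intro t ht
      rw [Submodule.mem_bot] at ht
      subst ht
      exact ⟨0, U.zero_mem, by simp, by simp⟩⟩
  obtain ⟨U', hU', hle, hsol⟩ := hL
  by_cases hLt : L = ⊤
  · obtain ⟨v, hv, hvt, -⟩ := hsol t (by rw [hLt]; trivial)
    exact ⟨v, hv, hvt⟩
  exfalso
  obtain ⟨f, hf0, hf⟩ := Submodule.exists_le_ker_of_lt_top L (lt_top_iff_ne_top.2 hLt)
  obtain ⟨x, hxU, hx⟩ := H f hf0 U' hU'
  have hxL : B x x ∉ L := fun h => hx (hf h)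
  refine hmax (L ⊔ Submodule.span k {B x x}) ?_ ?_
  · refine ⟨U' ⊓ LinearMap.ker (B x), hU'.inf (FC.ker _), inf_le_left.trans hle, ?_⟩
    intro t ht
    obtain ⟨a, ha, b, hb, rfl⟩ := Submodule.mem_sup.1 ht
    obtain ⟨c, rfl⟩ := Submodule.mem_span_singleton.1 hb
    obtain ⟨v, hvU, hva, hvo⟩ := hsol a ha
    obtain ⟨s, hs⟩ := IsAlgClosed.exists_pow_nat_eq c (n := 2) (by norm_num)
    refine ⟨v + s • x, U.add_mem hvU (U.smul_mem _ (hle hxU)), ?_, ?_⟩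
    · simp only [map_add, LinearMap.add_apply, map_smul, LinearMap.smul_apply, hvo x hxU,
        hB x v, hva, ← hs]
      simp [pow_two, mul_smul]
    · rintro y ⟨hy1, hy2⟩
      have hy2' : B x y = 0 := hy2
      simp [hvo y hy1, hy2']
  · refine lt_of_le_of_ne le_sup_left ?_
    intro h
    apply hxL
    rw [h]
    exact Submodule.mem_sup_right (Submodule.mem_span_singleton_self _)

variable (T : V →ₗ[k] V →ₗ[k] V →ₗ[k] k)

/-- Solving quadratic equations `T p v v = t p` for `p` in a finite-dimensional `P`. -/
lemma quad_solve' [IsAlgClosed k]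
    (hT1 : ∀ x y z, T x y z = T y x z) (hT2 : ∀ x y z, T x y z = T x z y)
    (P : Submodule k V) [Module.Finite k P] (hP : Disjoint P (KK T))
    {U : Submodule k V} (hU : FC U) (t : V →ₗ[k] k) : ∃ v ∈ U, ∀ p ∈ P, T p v v = t p := by
  have key : ∀ x y p, T x y p = T p x y := fun x y p => by rw [hT2, hT1]
  obtain ⟨v, hv, h⟩ := quad_solve (T.compr₂ (P.subtype.dualMap))
    (fun x y => by simp only [LinearMap.compr₂_apply]; congr 1; ext z; exact hT1 x y z)
    (fun f hf U hU => by
      obtain ⟨p, rfl⟩ := (Module.evalEquiv k P).surjective f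
      have hp : (p : V) ∉ KK T := by
        intro h
        have : (p : V) = 0 := by
          have := (Submodule.disjoint_def.1 hP) p p.2 h
          exact this
        apply hf
        have : p = 0 := Subtype.ext this
        rw [this, map_zero]
      obtain ⟨x, hxU, hx⟩ := exists_quad_ne T p hp hU
      refine ⟨x, hxU, ?_⟩
      rw [← key] at hx
      simpa using hx) hU (P.subtype.dualMap t)
  refine ⟨v, hv, fun p hp => ?_⟩
  have := LinearMap.congr_fun h ⟨p, hp⟩
  rw [← key]
  simpa using this

lemma disj_sup {P K : Submodule k V} (hP : Disjoint P K) {y : V} (hy : y ∉ K ⊔ P) :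
    Disjoint (P ⊔ Submodule.span k {y}) K := by
  rw [Submodule.disjoint_def] at *
  intro x hx hxK
  obtain ⟨a, ha, b, hb, rfl⟩ := Submodule.mem_sup.1 hx
  obtain ⟨c, rfl⟩ := Submodule.mem_span_singleton.1 hb
  have hc : c = 0 := by
    by_contra hc
    apply hy
    have : c • y ∈ K ⊔ P := by
      have : c • y = (a + c • y) + (-a) := by abel
      rw [this]
      exact Submodule.add_mem_sup hxK (P.neg_mem ha)
    simpa [smul_smul, hc] using (K ⊔ P).smul_mem c⁻¹ this
  subst hc
  simp only [zero_smul, add_zero] at *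
  exact hP a ha hxK

lemma exists_notMem {P K U : Submodule k V} [Module.Finite k P] (hK : ¬ FC K) (hU : FC U) :
    ∃ u ∈ U, u ∉ K ⊔ P := by
  by_contra! hc
  have h1 : FC (K ⊔ P) := hU.mono hc
  apply hK
  obtain ⟨n, l, c, π, hπ, hx⟩ := h1.exists_proj
  unfold FC
  rw [Module.finite_def]
  have : (⊤ : Submodule k (V ⧸ K)) =
      (P.map K.mkQ) ⊔ Submodule.span k (Set.range fun i => K.mkQ (c i)) := by
    rw [eq_comm, eq_top_iff]
    rintro x -
    obtain ⟨x, rfl⟩ := K.mkQ_surjective x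
    rw [hx x, map_add]
    refine Submodule.add_mem _ ?_ ?_
    · obtain ⟨a, ha, b, hb, h⟩ := Submodule.mem_sup.1 (hπ x)
      rw [← h, map_add]
      have : K.mkQ a = 0 := by simpa using ha
      rw [this, zero_add]
      exact Submodule.mem_sup_left ⟨b, hb, rfl⟩
    · apply Submodule.mem_sup_right
      simp only [map_sum, map_smul]
      exact Submodule.sum_mem _ fun i _ => Submodule.smul_mem _ _ (Submodule.subset_span ⟨i, rfl⟩)
  rw [this]
  refine Submodule.FG.sup (Submodule.FG.map _ ?_) (Submodule.fg_span (Set.finite_range _))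
  exact (Module.Finite.iff_fg).1 inferInstance

/-- `{y | T p u y = 0 for all p ∈ P}` -/
def orth (P : Submodule k V) (u : V) : Submodule k V where
  carrier := {y | ∀ p ∈ P, T p u y = 0}
  zero_mem' := by simp
  add_mem' := by intro a b ha hb p hp; simp [ha p hp, hb p hp]
  smul_mem' := by intro c a ha p hp; simp [ha p hp]

lemma FC_orth (P : Submodule k V) [Module.Finite k P] (u : V) : FC (orth T P u) := by
  obtain ⟨s, hs⟩ := (Module.Finite.iff_fg (N := P)).1 inferInstance
  refine (FC.biInf s (fun p => LinearMap.ker (T p u)) (fun _ _ => FC.ker _)).mono ?_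
  intro y hy p hp
  simp only [Submodule.mem_iInf, LinearMap.mem_ker] at hy
  rw [← hs] at hp
  induction hp using Submodule.span_induction with
  | mem x hx => exact hy x hx
  | zero => simp
  | add a b _ _ ha hb => simp [ha, hb]
  | smul c a _ ha => simp [ha]

lemma pm_notMem (hk2 : (2 : k) ≠ 0) {Q : Submodule k V} {u y : V} (hu : u ∉ Q) :
    u + y ∉ Q ∨ u + (-y) ∉ Q := by
  by_contra! hc
  apply hu
  have := Q.add_mem hc.1 hc.2
  have h2 : u + y + (u + -y) = (2 : k) • u := by rw [two_smul]; abel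
  rw [h2] at this
  simpa [smul_smul, hk2] using Q.smul_mem (2 : k)⁻¹ this

lemma infA' [IsAlgClosed k] (hk2 : (2 : k) ≠ 0)
    (hT1 : ∀ x y z, T x y z = T y x z) (hT2 : ∀ x y z, T x y z = T x z y)
    (hK : ¬ FC (KK T)) (P : Submodule k V) [Module.Finite k P] (hP : Disjoint P (KK T))
    {U : Submodule k V} (hU : FC U) (t : V →ₗ[k] k) :
    ∃ v ∈ U, v ∉ KK T ⊔ P ∧ ∀ p ∈ P, T p v v = t p := by
  obtain ⟨u, hu, huK⟩ := exists_notMem (P := P) hK hU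
  obtain ⟨y, ⟨hyU, hyo⟩, hy⟩ := quad_solve' T hT1 hT2 P hP (hU.inf (FC_orth T P u)) (t - T u u)
  have hs : ∀ p ∈ P, T p y u = 0 := fun p hp => by rw [hT2]; exact hyo p hp
  have hyo' : ∀ p ∈ P, T p u y = 0 := hyo
  have hp' : ∀ p, T u u p = T p u u := fun p => by rw [hT2, hT1]
  rcases pm_notMem hk2 (y := y) huK with h | h
  · refine ⟨_, U.add_mem hu hyU, h, fun p hp => ?_⟩
    simp [hs p hp, hyo' p hp, hy p hp, hp']
  · refine ⟨_, U.add_mem hu (U.neg_mem hyU), h, fun p hp => ?_⟩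
    simp [hs p hp, hyo' p hp, hy p hp, hp']

lemma cubic_root [IsAlgClosed k] (c A B : k) (hA : A ≠ 0) : ∃ s : k, c + A * s ^ 2 + B * s ^ 3 = 0 := by
  let p : Polynomial k := Polynomial.C c + Polynomial.C A * Polynomial.X ^ 2 +
    Polynomial.C B * Polynomial.X ^ 3
  have h2 : p.coeff 2 ≠ 0 := by
    simp [p, Polynomial.coeff_C, Polynomial.coeff_X_pow, hA]
  have hd : p.degree ≠ 0 := by
    intro h
    have := Polynomial.le_degree_of_ne_zero h2
    rw [h] at this
    norm_num at this
  obtain ⟨s, hs⟩ := IsAlgClosed.exists_root p hd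
  exact ⟨s, by simpa [p, Polynomial.IsRoot] using hs⟩

lemma infA [IsAlgClosed k] (hk2 : (2 : k) ≠ 0) (hk3 : (3 : k) ≠ 0)
    (hT1 : ∀ x y z, T x y z = T y x z) (hT2 : ∀ x y z, T x y z = T x z y)
    (hK : ¬ FC (KK T)) (P : Submodule k V) [Module.Finite k P] (hP : Disjoint P (KK T))
    {U : Submodule k V} (hU : FC U) (t : V →ₗ[k] k) :
    ∃ v ∈ U, T v v v = 0 ∧ ∀ p ∈ P, T p v v = t p := by
  obtain ⟨y, hyU, hyK, hy⟩ := infA' T hk2 hT1 hT2 hK P hP hU t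
  have hyP : y ∉ P := fun h => hyK (Submodule.mem_sup_right h)
  obtain ⟨g, hg0, hg⟩ := Submodule.exists_le_ker_of_notMem hyP
  obtain ⟨z, ⟨hzU, hzo, hzo2⟩, hz⟩ := quad_solve' T hT1 hT2 (P ⊔ Submodule.span k {y}) (disj_sup hP hyK)
    (hU.inf ((FC_orth T P y).inf (FC.ker (T y y)))) g
  have hzo' : ∀ p ∈ P, T p y z = 0 := hzo
  have hzo2' : T y y z = 0 := hzo2
  have h1 : ∀ p ∈ P, T p z z = 0 := fun p hp => by
    rw [hz p (Submodule.mem_sup_left hp)]; exact hg hp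
  have h2 : T y z z = g y := hz y (Submodule.mem_sup_right (Submodule.mem_span_singleton_self _))
  obtain ⟨s, hs⟩ := cubic_root (T y y y) (3 * T y z z) (T z z z)
    (mul_ne_zero hk3 (by rw [h2]; exact hg0))
  refine ⟨y + s • z, U.add_mem hyU (U.smul_mem _ hzU), ?_, fun p hp => ?_⟩
  · simp only [map_add, LinearMap.add_apply, map_smul, LinearMap.smul_apply, smul_eq_mul]
    rw [hT2 z z y, hT1 z y y, hT2 y z y, hT1 z y z, hzo2']
    linear_combination hs
  · simp only [map_add, LinearMap.add_apply, map_smul, LinearMap.smul_apply, smul_eq_mul]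
    rw [hT2 p z y, hzo' p hp, h1 p hp, hy p hp]
    ring

lemma infB [IsAlgClosed k] (hk2 : (2 : k) ≠ 0) (hk3 : (3 : k) ≠ 0)
    (hT1 : ∀ x y z, T x y z = T y x z) (hT2 : ∀ x y z, T x y z = T x z y)
    (hK : ¬ FC (KK T)) (P : Submodule k V) [Module.Finite k P] (hP : Disjoint P (KK T))
    {U : Submodule k V} (hU : FC U) (t : V →ₗ[k] k) :
    ∃ v ∈ U, v ∉ KK T ⊔ P ∧ T v v v = 0 ∧ ∀ p ∈ P, T p v v = t p := by
  obtain ⟨u, hu, huK⟩ := exists_notMem (P := P) hK hU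
  have huP : u ∉ P := fun h => huK (Submodule.mem_sup_right h)
  obtain ⟨g, hg0, hg⟩ := Submodule.exists_le_ker_of_notMem huP
  let a : k := (-(T u u u) / 3 - (t u - T u u u)) / g u
  obtain ⟨y, ⟨hyU, hyo, hyo2⟩, hyF, hy⟩ := infA T hk2 hk3 hT1 hT2 hK (P ⊔ Submodule.span k {u})
    (disj_sup hP huK) (hU.inf ((FC_orth T P u).inf (FC.ker (T u u)))) (t - T u u + a • g)
  have hyo' : ∀ p ∈ P, T p u y = 0 := hyo
  have hyo2' : T u u y = 0 := hyo2
  have h1 : ∀ p ∈ P, T p y y = t p - T p u u := fun p hp => by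
    have hgp : g p = 0 := hg hp
    rw [hy p (Submodule.mem_sup_left hp)]
    simp [hgp, hT2 u u p, hT1 u p u]
  have h2 : T u y y = -(T u u u) / 3 := by
    rw [hy u (Submodule.mem_sup_right (Submodule.mem_span_singleton_self _))]
    simp only [LinearMap.add_apply, LinearMap.sub_apply, LinearMap.smul_apply, smul_eq_mul, a]
    field_simp
    ring
  have h3 : 3 * T u y y = - T u u u := by rw [h2]; field_simp
  rcases pm_notMem hk2 (y := y) huK with h | h
  · refine ⟨_, U.add_mem hu hyU, h, ?_, fun p hp => ?_⟩
    · simp only [map_add, LinearMap.add_apply]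
      rw [hT2 y y u, hT1 y u u, hT2 u y u, hT1 y u y, hyo2', hyF]
      linear_combination h3
    · simp only [map_add, LinearMap.add_apply]
      rw [hT2 p y u, hyo' p hp, h1 p hp]
      ring
  · refine ⟨_, U.add_mem hu (U.neg_mem hyU), h, ?_, fun p hp => ?_⟩
    · simp only [map_add, LinearMap.add_apply, map_neg, LinearMap.neg_apply]
      rw [hT2 y y u, hT1 y u u, hT2 u y u, hT1 y u y, hyo2', hyF]
      linear_combination h3
    · simp only [map_add, LinearMap.add_apply, map_neg, LinearMap.neg_apply]
      rw [hT2 p y u, hyo' p hp, h1 p hp]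
      ring

lemma finB [IsAlgClosed k] (hk2 : (2 : k) ≠ 0) (hk3 : (3 : k) ≠ 0)
    (hT1 : ∀ x y z, T x y z = T y x z) (hT2 : ∀ x y z, T x y z = T x z y)
    (hT : ¬ FiniteStrengthCubic k T)
    (hK : FC (KK T)) (P : Submodule k V) [Module.Finite k P]
    {U : Submodule k V} (hU : FC U) :
    ∃ z ∈ U ⊓ KK T, T z z z ≠ 0 ∧ ∀ p ∈ P, T p z z = 0 := by
  classical
  haveI : Inhabited V := ⟨0⟩
  obtain ⟨f, hf⟩ := seq_exists (fun n (f : ℕ → V) v => v ∈ U ⊓ KK T ∧ T v v v ≠ 0 ∧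
      ∀ i < n, T (f i) v = 0)
    (by
      rintro n f g v hfg ⟨h1, h2, h3⟩
      exact ⟨h1, h2, fun i hi => by rw [← hfg i hi]; exact h3 i hi⟩)
    (by
      intro n f h
      have h1 : FC (⨅ i ∈ Finset.range n, LinearMap.ker (T (f i))) :=
        FC.biInf _ _ fun i hi => FC_rad hk2 hk3 T hT2 (h i (Finset.mem_range.1 hi)).1.2
      obtain ⟨x, ⟨hx1, hx2⟩, hx⟩ := exists_cubic_ne T hT1 hT2 hT ((hU.inf hK).inf h1)
      refine ⟨x, hx1, hx, fun i hi => ?_⟩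
      simp only [SetLike.mem_coe, Submodule.mem_iInf, LinearMap.mem_ker] at hx2
      exact hx2 i (Finset.mem_range.2 hi))
  have horth : ∀ i j, i ≠ j → ∀ y, T (f i) (f j) y = 0 := by
    intro i j hij y
    rcases lt_or_gt_of_ne hij with h | h
    · rw [(hf j).2.2 i h]; simp
    · rw [hT1, (hf i).2.2 j h]; simp
  let Q : ℕ → (P →ₗ[k] k) := fun n => P.subtype.dualMap (T (f n) (f n))
  have hQ : ¬ LinearIndependent k Q := fun h => by
    have := h.finite
    exact not_finite ℕ
  rw [not_linearIndependent_iff] at hQ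
  obtain ⟨s, g, hsum, i, his, hgi⟩ := hQ
  choose r hr using fun c : k => IsAlgClosed.exists_pow_nat_eq c (n := 2) (by norm_num)
  let y : V := ∑ j ∈ s.erase i, r (g j) • f j
  have hyo : ∀ w, T y (f i) w = 0 := by
    intro w
    simp only [y, map_sum, LinearMap.sum_apply, map_smul, LinearMap.smul_apply, smul_eq_mul]
    refine Finset.sum_eq_zero fun j hj => ?_
    rw [horth j i (Finset.ne_of_mem_erase hj), mul_zero]
  have hfj : ∀ p j l, j ≠ l → T p (f j) (f l) = 0 := fun p j l h => by
    rw [hT1, hT2]; exact horth _ _ h _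
  have hyy : ∀ p, T p y y = ∑ j ∈ s.erase i, g j * T p (f j) (f j) := by
    intro p
    simp only [y, map_sum, LinearMap.sum_apply, map_smul, LinearMap.smul_apply, smul_eq_mul]
    refine Finset.sum_congr rfl fun j hj => ?_
    rw [Finset.sum_eq_single j]
    · rw [← hr (g j)]; simp only [hr]; rw [← mul_assoc, ← pow_two, hr]
    · intro l _ hl
      rw [hfj p _ _ hl]; simp
    · intro h; exact absurd hj h
  have hz : ∀ p ∈ P, T p y y + g i * T p (f i) (f i) = 0 := by
    intro p hp
    have := LinearMap.congr_fun hsum ⟨p, hp⟩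
    rw [hyy, Finset.sum_erase_add _ _ his]
    simp only [LinearMap.sum_apply, LinearMap.smul_apply, Q, LinearMap.dualMap_apply,
      Submodule.subtype_apply, smul_eq_mul, LinearMap.zero_apply] at this
    rw [← this]
    refine Finset.sum_congr rfl fun j _ => ?_
    rw [hT2 (f j) (f j) p, hT1 (f j) p]
  have hyU : y ∈ U ⊓ KK T := Submodule.sum_mem _ fun j _ => Submodule.smul_mem _ _ (hf j).1
  have main : ∀ e : k, e ^ 2 = g i → T (y + e • f i) (y + e • f i) (y + e • f i) ≠ 0 →
      ∃ z ∈ U ⊓ KK T, T z z z ≠ 0 ∧ ∀ p ∈ P, T p z z = 0 := by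
    intro e he hne
    refine ⟨y + e • f i, Submodule.add_mem _ hyU (Submodule.smul_mem _ _ (hf i).1), hne, ?_⟩
    intro p hp
    simp only [map_add, LinearMap.add_apply, map_smul, LinearMap.smul_apply, smul_eq_mul]
    rw [hT2 p (f i) y, hT1 p y (f i), hT2 y p (f i), hyo]
    linear_combination hz p hp + T p (f i) (f i) * he
  have hexp : ∀ e : k, T (y + e • f i) (y + e • f i) (y + e • f i) =
      T y y y + e ^ 3 * T (f i) (f i) (f i) := by
    intro e
    simp only [map_add, LinearMap.add_apply, map_smul, LinearMap.smul_apply, smul_eq_mul]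
    rw [hT2 y y (f i), hT1 (f i) y, hT1 (f i) y, hT2 (f i) (f i) y, hT1 (f i) y]
    simp only [hyo]
    ring
  by_cases h0 : T (y + r (g i) • f i) (y + r (g i) • f i) (y + r (g i) • f i) = 0
  · refine main (-r (g i)) (by rw [neg_sq, hr]) ?_
    rw [hexp] at h0 ⊢
    intro h1
    have h2 : 2 * (r (g i) * g i) * T (f i) (f i) (f i) = 0 := by
      rw [← hr (g i)]; simp only [hr]
      have := hr (g i)
      linear_combination h0 - h1 - 2 * (r (g i)) * T (f i) (f i) (f i) * this
    have h3 : r (g i) ≠ 0 := by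
      intro h; apply hgi; rw [← hr (g i), h]; ring
    exact mul_ne_zero (mul_ne_zero hk2 (mul_ne_zero h3 hgi)) (hf i).2.1 h2
  · exact main _ (hr _) h0

lemma finC [IsAlgClosed k] (hk2 : (2 : k) ≠ 0) (hk3 : (3 : k) ≠ 0)
    (hT1 : ∀ x y z, T x y z = T y x z) (hT2 : ∀ x y z, T x y z = T x z y)
    (hT : ¬ FiniteStrengthCubic k T)
    (hK : FC (KK T)) (P : Submodule k V) [Module.Finite k P] (hP : Disjoint P (KK T))
    {U : Submodule k V} (hU : FC U) (t : V →ₗ[k] k) (d : k) :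
    ∃ v ∈ U ⊓ KK T, T v v v = d ∧ ∀ p ∈ P, T p v v = t p := by
  obtain ⟨y, hyU, hy⟩ := quad_solve' T hT1 hT2 P hP (hU.inf hK) t
  obtain ⟨z, ⟨⟨hzU, hzy⟩, hzK⟩, hz, hzp⟩ := finB T hk2 hk3 hT1 hT2 hT hK P
    (hU.inf (FC_rad hk2 hk3 T hT2 hyU.2))
  obtain ⟨s, hs⟩ := IsAlgClosed.exists_pow_nat_eq ((d - T y y y) / T z z z) (n := 3) (by norm_num)
  have hs' : s ^ 3 * T z z z = d - T y y y := by rw [hs]; field_simp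
  have hyz : T y z = 0 := hzy
  have hyz' : ∀ w, T y z w = 0 := fun w => by rw [hyz]; rfl
  refine ⟨y + s • z, Submodule.add_mem _ hyU (Submodule.smul_mem _ _ ⟨hzU, hzK⟩), ?_, fun p hp => ?_⟩
  · simp only [map_add, LinearMap.add_apply, map_smul, LinearMap.smul_apply, smul_eq_mul]
    rw [hT2 y y z, hT1 z y, hT1 z y, hT2 z z y, hT1 z y]
    simp only [hyz']
    linear_combination hs'
  · simp only [map_add, LinearMap.add_apply, map_smul, LinearMap.smul_apply, smul_eq_mul]
    rw [hT2 p z y, hT1 p y z, hT2 y p z, hyz', hzp p hp, hy p hp]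
    ring

end Solve

section Model

variable {k : Type*} {V : Type*} [Field k] [AddCommGroup V] [Module k V]
variable (T : V →ₗ[k] V →ₗ[k] V →ₗ[k] k)

lemma infSeq [IsAlgClosed k] (hk2 : (2 : k) ≠ 0) (hk3 : (3 : k) ≠ 0)
    (hT1 : ∀ x y z, T x y z = T y x z) (hT2 : ∀ x y z, T x y z = T x z y)
    (hK : ¬ FC (KK T)) (c : ℕ → ℕ → k) :
    ∃ v : ℕ → V, ∀ l, (∀ i < l, ∀ j < l, T (v i) (v j) (v l) = 0) ∧
      (∀ i < l, T (v i) (v l) (v l) = c i l) ∧ T (v l) (v l) (v l) = 0 := by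
  have : Inhabited V := ⟨0⟩
  obtain ⟨f, hf⟩ := seq_exists (fun n (f : ℕ → V) v =>
      v ∉ KK T ⊔ Submodule.span k (f '' Set.Iio n) ∧ (∀ i < n, ∀ j < n, T (f i) (f j) v = 0) ∧
      (∀ i < n, T (f i) v v = c i n) ∧ T v v v = 0)
    (by
      rintro n f g v hfg ⟨h1, h2, h3, h4⟩
      refine ⟨?_, fun i hi j hj => ?_, fun i hi => ?_, h4⟩
      · have hh : f '' Set.Iio n = g '' Set.Iio n := Set.image_congr (fun i hi => hfg i hi)
        rwa [← hh]
      · rw [← hfg i hi, ← hfg j hj]; exact h2 i hi j hj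
      · rw [← hfg i hi]; exact h3 i hi)
    (by
      intro n f h
      have hfin : ∀ n, Module.Finite k (Submodule.span k (f '' Set.Iio n)) := fun n =>
        FiniteDimensional.span_of_finite k ((Set.finite_Iio n).image f)
      have hind : ∀ m ≤ n, Disjoint (Submodule.span k (f '' Set.Iio m)) (KK T) ∧
          ∀ c : ℕ → k, ∃ t : V →ₗ[k] k, ∀ i < m, t (f i) = c i := by
        intro m
        induction m with
        | zero => intro _; simp
        | succ m ih =>
          intro hm
          obtain ⟨h1, h2⟩ := ih (by omega)
          have h3 := (h m (by omega)).1
          constructor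
          · have : f '' Set.Iio (m + 1) = f '' Set.Iio m ∪ {f m} := by
              rw [← Set.image_singleton, ← Set.image_union]
              congr 1
              ext; simp
            rw [this, Submodule.span_union]
            exact disj_sup h1 h3
          · intro c
            obtain ⟨t, ht⟩ := h2 c
            obtain ⟨g, hg0, hg⟩ := Submodule.exists_le_ker_of_notMem h3
            refine ⟨t + ((c m - t (f m)) / g (f m)) • g, fun i hi => ?_⟩
            rcases Nat.lt_succ_iff_lt_or_eq.1 hi with hi | rfl
            · have : g (f i) = 0 := hg (Submodule.mem_sup_right (Submodule.subset_span ⟨i, hi, rfl⟩))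
              simp [this, ht i hi]
            · simp [hg0]
      obtain ⟨h1, h2⟩ := hind n le_rfl
      obtain ⟨t, ht⟩ := h2 (fun i => c i n)
      have hU : FC (⨅ i ∈ Finset.range n, ⨅ j ∈ Finset.range n, LinearMap.ker (T (f i) (f j))) :=
        FC.biInf _ _ fun i _ => FC.biInf _ _ fun j _ => FC.ker _
      have := hfin n
      obtain ⟨v, hvU, hvK, hv, hvt⟩ := infB T hk2 hk3 hT1 hT2 hK _ h1 hU t
      simp only [Submodule.mem_iInf, LinearMap.mem_ker, Finset.mem_range] at hvU
      refine ⟨v, hvK, fun i hi j hj => hvU i hi j hj, fun i hi => ?_, hv⟩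
      rw [← ht i hi]
      exact hvt _ (Submodule.subset_span ⟨i, hi, rfl⟩))
  exact ⟨f, fun l => (hf l).2⟩

/-- The model configuration of vectors. -/
def IsModel (A : ℕ → Prop) (X : ℕ → V) (Y : ℕ × ℕ × Fin 4 → V) : Prop :=
  (∀ a, ¬ A a → X a = 0) ∧ (∀ a b j, T (X a) (X b) (Y j) = 0) ∧
  (∀ a i j, i ≠ j → T (X a) (Y i) (Y j) = 0) ∧
  (∀ a j, A a → j.1 = a → T (X a) (Y j) (Y j) = 1) ∧
  (∀ a j, j.1 ≠ a → T (X a) (Y j) (Y j) = 0) ∧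
  (∀ i j l, ¬ (i = j ∧ j = l) → T (Y i) (Y j) (Y l) = 0) ∧
  (∀ j, A j.1 → T (Y j) (Y j) (Y j) = 0) ∧ (∀ j, ¬ A j.1 → T (Y j) (Y j) (Y j) = 1)

lemma infModel [IsAlgClosed k] (hk2 : (2 : k) ≠ 0) (hk3 : (3 : k) ≠ 0)
    (hT1 : ∀ x y z, T x y z = T y x z) (hT2 : ∀ x y z, T x y z = T x z y)
    (hK : ¬ FC (KK T)) : ∃ X Y, IsModel T (fun _ => True) X Y := by
  classical
  let code : ℕ × ℕ × Fin 4 → ℕ := fun j => 2 * Nat.pair j.1 (Encodable.encode j) + 1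
  have hcode : Function.Injective code := by
    intro i j h
    have h' : Nat.pair i.1 (Encodable.encode i) = Nat.pair j.1 (Encodable.encode j) := by
      simp only [code] at h; omega
    exact Encodable.encode_injective (Nat.pair_eq_pair.1 h').2
  have hlt : ∀ j, 2 * j.1 < code j := fun j => by
    have := Nat.left_le_pair j.1 (Encodable.encode j)
    simp only [code]; omega
  have hodd : ∀ a j, 2 * a ≠ code j := fun a j => by simp only [code]; omega
  obtain ⟨v, hv⟩ := infSeq T hk2 hk3 hT1 hT2 hK
    (fun i l => if ∃ j, l = code j ∧ i = 2 * j.1 then 1 else 0)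
  have hE : ∀ i l, i ≠ l → T (v i) (v l) (v l) =
      if i < l then (if ∃ j, l = code j ∧ i = 2 * j.1 then 1 else 0) else 0 := by
    intro i l hil
    split_ifs with h1 h2
    · rw [(hv l).2.1 i h1, if_pos h2]
    · rw [(hv l).2.1 i h1, if_neg h2]
    · rw [hT1, hT2, (hv i).1 l (by omega) l (by omega)]
  have hD : ∀ i j l, i ≠ j → j ≠ l → i ≠ l → T (v i) (v j) (v l) = 0 := by
    intro i j l h1 h2 h3
    rcases lt_or_gt_of_ne h1 with h1 | h1
    · rcases lt_or_gt_of_ne h2 with h2 | h2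
      · exact (hv l).1 i (by omega) j h2
      · rw [hT2]; exact (hv j).1 i (by omega) l h2
    · rcases lt_or_gt_of_ne h3 with h3 | h3
      · exact (hv l).1 i (by omega) j (by omega)
      · rw [hT1, hT2]; exact (hv i).1 j (by omega) l (by omega)
  have hYY : ∀ i j, i ≠ j → T (v (code i)) (v (code j)) (v (code j)) = 0 := by
    intro i j hij
    rw [hE _ _ (hcode.ne hij)]
    split_ifs with h1 h2
    · obtain ⟨m, -, hm⟩ := h2
      exact absurd hm.symm (hodd _ _)
    · rfl
    · rfl
  refine ⟨fun a => v (2 * a), fun j => v (code j), fun a h => absurd trivial h, ?_, ?_, ?_, ?_, ?_,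
    fun j _ => (hv _).2.2, fun j h => absurd trivial h⟩
  · intro a b j
    by_cases hab : a = b
    · subst hab
      dsimp only
      rw [hT2, hT1, hE _ _ (hodd a j).symm]
      split_ifs with h1 h2
      · obtain ⟨m, hm, -⟩ := h2
        exact absurd hm (hodd _ _)
      · rfl
      · rfl
    · exact hD _ _ _ (by omega) (hodd _ _) (hodd _ _)
  · intro a i j hij
    exact hD _ _ _ (hodd _ _) (hcode.ne hij) (hodd _ _)
  · intro a j _ hj
    dsimp only
    rw [hE _ _ (hodd a j), ← hj, if_pos (hlt j), if_pos ⟨j, rfl, rfl⟩]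
  · intro a j hj
    dsimp only
    rw [hE _ _ (hodd a j)]
    split_ifs with h1 h2
    · obtain ⟨m, hm, hm2⟩ := h2
      have := hcode hm
      subst this
      omega
    · rfl
    · rfl
  · intro i j l h
    dsimp only
    by_cases h1 : i = j
    · subst h1
      have h2 : i ≠ l := fun h2 => h ⟨rfl, h2⟩
      rw [hT2, hT1]
      exact hYY _ _ h2.symm
    · by_cases h2 : j = l
      · subst h2; exact hYY _ _ h1
      · by_cases h3 : i = l
        · subst h3
          rw [hT1]
          exact hYY _ _ (Ne.symm h1)
        · exact hD _ _ _ (hcode.ne h1) (hcode.ne h2) (hcode.ne h3)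

lemma finModel [IsAlgClosed k] (hk2 : (2 : k) ≠ 0) (hk3 : (3 : k) ≠ 0)
    (hT1 : ∀ x y z, T x y z = T y x z) (hT2 : ∀ x y z, T x y z = T x z y)
    (hT : ¬ FiniteStrengthCubic k T) (hK : FC (KK T)) :
    ∃ X Y, IsModel T (fun a => a < Module.finrank k (V ⧸ KK T)) X Y := by
  classical
  have hK' : Module.Finite k (V ⧸ KK T) := hK
  let b := Module.finBasis k (V ⧸ KK T)
  set r := Module.finrank k (V ⧸ KK T) with hr
  obtain ⟨s, hs⟩ := (KK T).mkQ.exists_rightInverse_of_surjective (by simp)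
  have hs' : ∀ q, (KK T).mkQ (s q) = q := fun q => LinearMap.congr_fun hs q
  let P := LinearMap.range s
  have hP : Disjoint P (KK T) := by
    rw [Submodule.disjoint_def]
    rintro _ ⟨q, rfl⟩ hq
    have : (KK T).mkQ (s q) = 0 := by simpa using hq
    rw [hs' q] at this
    rw [this, map_zero]
  let X : ℕ → V := fun a => if h : a < r then s (b ⟨a, h⟩) else 0
  have hXP : ∀ a, X a ∈ P := by
    intro a
    simp only [X]
    split_ifs
    · exact ⟨_, rfl⟩
    · exact P.zero_mem
  let τ : ℕ → V →ₗ[k] k := fun a => if h : a < r then b.coord ⟨a, h⟩ ∘ₗ (KK T).mkQ else 0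
  have hτ1 : ∀ a, a < r → τ a (X a) = 1 := by
    intro a ha
    simp only [τ, X, dif_pos ha, LinearMap.comp_apply, hs']
    simp
  have hτ2 : ∀ a c, a ≠ c → τ a (X c) = 0 := by
    intro a c hac
    simp only [τ, X]
    split_ifs with h1 h2
    · simp only [LinearMap.comp_apply, hs']
      simp [hac.symm]
    · simp
    · simp
    · simp
  let dec : ℕ → ℕ × ℕ × Fin 4 := Function.invFun Encodable.encode
  have hdec : ∀ j, dec (Encodable.encode j) = j :=
    Function.leftInverse_invFun Encodable.encode_injective
  have : Inhabited V := ⟨0⟩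
  obtain ⟨f, hf⟩ := seq_exists (fun n (f : ℕ → V) v =>
      v ∈ KK T ∧ (∀ i j, T (X i) (X j) v = 0) ∧ (∀ i < n, T (f i) v = 0) ∧
      T v v v = (if (dec n).1 < r then 0 else 1) ∧ (∀ p ∈ P, T p v v = τ (dec n).1 p))
    (by
      rintro n f g v hfg ⟨h1, h2, h3, h4⟩
      refine ⟨h1, h2, fun i hi => ?_, h4⟩
      rw [← hfg i hi]; exact h3 i hi)
    (by
      intro n f h
      have h1 : FC (⨅ i ∈ Finset.range n, LinearMap.ker (T (f i))) :=
        FC.biInf _ _ fun i hi => FC_rad hk2 hk3 T hT2 (h i (Finset.mem_range.1 hi)).1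
      have hU : FC (⨅ i ∈ Finset.range r, ⨅ j ∈ Finset.range r, LinearMap.ker (T (X i) (X j))) :=
        FC.biInf _ _ fun i _ => FC.biInf _ _ fun j _ => FC.ker _
      obtain ⟨v, ⟨⟨hv1, hvU⟩, hvK⟩, hv, hvt⟩ := finC T hk2 hk3 hT1 hT2 hT hK P hP (h1.inf hU)
        (τ (dec n).1) (if (dec n).1 < r then 0 else 1)
      simp only [SetLike.mem_coe, Submodule.mem_iInf, LinearMap.mem_ker, Finset.mem_range] at hv1 hvU
      refine ⟨v, hvK, fun i j => ?_, hv1, hv, hvt⟩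
      by_cases hi : i < r
      · by_cases hj : j < r
        · exact hvU i hi j hj
        · have : X j = 0 := dif_neg hj
          simp [this]
      · have : X i = 0 := dif_neg hi
        simp [this])
  have horth : ∀ i j, i ≠ j → ∀ y, T (f i) (f j) y = 0 := by
    intro i j hij y
    rcases lt_or_gt_of_ne hij with h | h
    · rw [(hf j).2.2.1 i h]; simp
    · rw [hT1, (hf i).2.2.1 j h]; simp
  have hfX : ∀ a n, T (X a) (f n) (f n) = τ (dec n).1 (X a) := fun a n => (hf n).2.2.2.2 _ (hXP a)
  have hinj : ∀ {i j : ℕ × ℕ × Fin 4}, i ≠ j → Encodable.encode i ≠ Encodable.encode j :=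
    fun h => Encodable.encode_injective.ne h
  refine ⟨X, fun j => f (Encodable.encode j), fun a ha => dif_neg ha,
    fun a b j => (hf _).2.1 a b, ?_, ?_, ?_, ?_, ?_, ?_⟩
  · intro a i j hij
    rw [hT1, hT2]
    exact horth _ _ (hinj hij) _
  · intro a j ha hj
    dsimp only
    rw [hfX, hdec, hj]
    exact hτ1 a ha
  · intro a j hj
    dsimp only
    rw [hfX, hdec]
    exact hτ2 _ _ hj
  · intro i j l h
    dsimp only
    by_cases h1 : i = j
    · have h2 : j ≠ l := fun h2 => h ⟨h1, h2⟩
      rw [hT1, hT2]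
      exact horth _ _ (hinj h2) _
    · exact horth _ _ (hinj h1) _
  · intro j hj
    dsimp only
    rw [(hf _).2.2.2.1, hdec, if_pos hj]
  · intro j hj
    dsimp only
    rw [(hf _).2.2.2.1, hdec, if_neg hj]

end Model

section Source

variable {k : Type*} [Field k]

/-- tail projection -/
noncomputable def tl (a : ℕ) : (ℕ →₀ k) →ₗ[k] (ℕ →₀ k) where
  toFun w := w.filter (fun n => a ≤ n)
  map_add' x y := Finsupp.filter_add
  map_smul' c x := Finsupp.filter_smul

lemma tl_apply (a n : ℕ) (w : ℕ →₀ k) : tl a w n = if a ≤ n then w n else 0 := by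
  simp [tl, Finsupp.filter_apply]

lemma tl_zero (w : ℕ →₀ k) : tl 0 w = w := by
  ext n; simp [tl_apply]

lemma tl_succ (a : ℕ) (w : ℕ →₀ k) : tl (a + 1) w = tl a w - w a • Finsupp.single a 1 := by
  ext n
  simp only [tl_apply, Finsupp.sub_apply, Finsupp.smul_apply, Finsupp.single_apply, smul_eq_mul]
  rcases lt_trichotomy n a with h | h | h
  · rw [if_neg (by omega), if_neg (by omega), if_neg (by omega)]; simp
  · subst h; simp
  · rw [if_pos (by omega), if_pos (by omega), if_neg (by omega)]; simp

lemma tl_eq_zero {a : ℕ} {w : ℕ →₀ k} (h : ∀ n, a ≤ n → w n = 0) : tl a w = 0 := by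
  ext n
  simp only [tl_apply, Finsupp.zero_apply]
  split_ifs with h1
  · exact h n h1
  · rfl

lemma exists_bound (w : ℕ →₀ k) : ∃ N, ∀ n, N ≤ n → w n = 0 := by
  refine ⟨w.support.sup id + 1, fun n hn => ?_⟩
  by_contra h
  have : n ≤ w.support.sup id := Finset.le_sup (f := id) (Finsupp.mem_support_iff.2 h)
  omega

lemma tele3 (S : (ℕ →₀ k) →ₗ[k] (ℕ →₀ k) →ₗ[k] (ℕ →₀ k) →ₗ[k] k)
    (hS1 : ∀ x y z, S x y z = S y x z) (hS2 : ∀ x y z, S x y z = S x z y) (w : ℕ →₀ k) (N : ℕ) :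
    S w w w = ∑ a ∈ Finset.range N, w a * (3 * S (Finsupp.single a 1) (tl a w) (tl a w) +
      w a * (w a * S (Finsupp.single a 1) (Finsupp.single a 1) (Finsupp.single a 1) -
        3 * S (Finsupp.single a 1) (Finsupp.single a 1) (tl a w))) +
      S (tl N w) (tl N w) (tl N w) := by
  induction N with
  | zero => simp [tl_zero]
  | succ N ih =>
    rw [Finset.sum_range_succ, ih, tl_succ]
    simp only [map_sub, LinearMap.sub_apply, map_smul, LinearMap.smul_apply, smul_eq_mul]
    generalize Finsupp.single N (1 : k) = e
    generalize tl N w = u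
    rw [hS2 u u e, hS1 u e u, hS1 u e e, hS2 e u e]
    ring

lemma tele2 (B : (ℕ →₀ k) →ₗ[k] (ℕ →₀ k) →ₗ[k] k)
    (hB : ∀ x y, B x y = B y x) (w : ℕ →₀ k) (N : ℕ) :
    B w w = ∑ b ∈ Finset.range N, w b * (2 * B (Finsupp.single b 1) (tl b w) -
      w b * B (Finsupp.single b 1) (Finsupp.single b 1)) + B (tl N w) (tl N w) := by
  induction N with
  | zero => simp [tl_zero]
  | succ N ih =>
    rw [Finset.sum_range_succ, ih, tl_succ]
    simp only [map_sub, LinearMap.sub_apply, map_smul, LinearMap.smul_apply, smul_eq_mul]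
    generalize Finsupp.single N (1 : k) = e
    generalize tl N w = u
    rw [hB u e]
    ring

lemma source_decomp (S : (ℕ →₀ k) →ₗ[k] (ℕ →₀ k) →ₗ[k] (ℕ →₀ k) →ₗ[k] k)
    (hS2 : ∀ x y z, S x y z = S x z y) (a : ℕ) :
    ∃ l m : ℕ → (ℕ →₀ k) →ₗ[k] k,
      (∀ w, tl a w = 0 → ∀ b, l b w = 0 ∧ m b w = 0) ∧
      (∀ w, ∃ M0, ∀ M ≥ M0, l M w = 0 ∧ m M w = 0 ∧ ∑ b ∈ Finset.range M, l b w * m b w =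
        3 * S (Finsupp.single a 1) (tl a w) (tl a w) +
      w a * (w a * S (Finsupp.single a 1) (Finsupp.single a 1) (Finsupp.single a 1) -
        3 * S (Finsupp.single a 1) (Finsupp.single a 1) (tl a w))) ∧
      ((Finsupp.single a 1) ∈ KK S → ∃ N0, ∀ b ≥ N0, l b = 0 ∧ m b = 0) := by
  classical
  let e : ℕ → (ℕ →₀ k) := fun n => Finsupp.single n 1
  let l0 : (ℕ →₀ k) →ₗ[k] k := Finsupp.lapply a
  let m0 : (ℕ →₀ k) →ₗ[k] k := S (e a) (e a) (e a) • Finsupp.lapply a -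
    (3 : k) • (S (e a) (e a) ∘ₗ tl a)
  have hl0 : ∀ w : ℕ →₀ k, tl a w = 0 → w a = 0 := fun w hw => by
    have := tl_apply a a w
    rw [hw] at this
    simpa using this.symm
  have hm0 : ∀ w : ℕ →₀ k, tl a w = 0 → m0 w = 0 := fun w hw => by simp [m0, hl0 w hw, hw]
  by_cases h : (Finsupp.single a 1) ∈ KK S
  · have h' := h
    rw [mem_KK] at h'
    obtain ⟨n, l, m, hlm⟩ := h'
    let L : ℕ → (ℕ →₀ k) →ₗ[k] k := fun b => Nat.casesOn b l0
      (fun i => if hi : i < n then l ⟨i, hi⟩ ∘ₗ tl a else 0)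
    let M : ℕ → (ℕ →₀ k) →ₗ[k] k := fun b => Nat.casesOn b m0
      (fun i => if hi : i < n then m ⟨i, hi⟩ ∘ₗ tl a else 0)
    have hbig : ∀ b ≥ n + 1, L b = 0 ∧ M b = 0 := by
      intro b hb
      obtain ⟨c, rfl⟩ : ∃ c, b = c + 1 := ⟨b - 1, by omega⟩
      have hc : ¬ c < n := by omega
      exact ⟨dif_neg hc, dif_neg hc⟩
    refine ⟨L, M, ?_, ?_, fun _ => ⟨n + 1, hbig⟩⟩
    · intro w hw b
      cases b with
      | zero => exact ⟨hl0 w hw, hm0 w hw⟩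
      | succ b =>
        simp only [L, M]
        split_ifs <;> simp [hw]
    · intro w
      refine ⟨n + 1, fun R hR => ⟨by rw [(hbig R hR).1]; rfl, by rw [(hbig R hR).2]; rfl, ?_⟩⟩
      have : ∑ b ∈ Finset.range R, L b w * M b w = ∑ b ∈ Finset.range (n + 1), L b w * M b w := by
        symm
        apply Finset.sum_subset
        · intro x; simp; omega
        · intro x _ hx
          rw [(hbig x (by simpa using hx)).1]; simp
      rw [this, Finset.sum_range_succ', hlm, Finset.sum_range]
      congr 1
      · refine Finset.sum_congr rfl fun i _ => ?_
        simp [L, M]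
      · simp [L, M, l0, m0, e]
        left; ring
  · let B := (3 : k) • S (e a)
    let L : ℕ → (ℕ →₀ k) →ₗ[k] k := fun b => Nat.casesOn b l0
      (fun i => Finsupp.lapply i ∘ₗ tl a)
    let M : ℕ → (ℕ →₀ k) →ₗ[k] k := fun b => Nat.casesOn b m0
      (fun i => ((2 : k) • (B (e i) ∘ₗ tl i) - B (e i) (e i) • Finsupp.lapply i) ∘ₗ tl a)
    refine ⟨L, M, ?_, ?_, fun h' => absurd h' h⟩
    · intro w hw b
      cases b with
      | zero => exact ⟨hl0 w hw, hm0 w hw⟩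
      | succ b => simp [L, M, hw]
    · intro w
      obtain ⟨N, hN⟩ := exists_bound (tl a w)
      refine ⟨N + 1, fun R hR => ?_⟩
      obtain ⟨c, rfl⟩ : ∃ c, R = c + 1 := ⟨R - 1, by omega⟩
      have h1 : tl a w c = 0 := hN c (by omega)
      have h2 : tl c (tl a w) = 0 := tl_eq_zero fun n hn => hN n (by omega)
      refine ⟨by simp [L, h1], by simp [M, h1, h2], ?_⟩
      have h3 : 3 * S (Finsupp.single a 1) (tl a w) (tl a w) = B (tl a w) (tl a w) := by simp [B, e]
      rw [Finset.sum_range_succ', h3, tele2 B (fun x y => by simp [B, hS2 (e a) x y]) (tl a w) c, h2]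
      congr 1
      · simp only [map_zero, add_zero]
        refine Finset.sum_congr rfl fun i _ => ?_
        simp [L, M, e]
        left; ring
      · simp [L, M, l0, m0, e]
        left; ring

/-- pullback of a trilinear form -/
noncomputable def pull {V W : Type*} [AddCommGroup V] [Module k V] [AddCommGroup W] [Module k W]
    (T : V →ₗ[k] V →ₗ[k] V →ₗ[k] k) (φ : W →ₗ[k] V) : W →ₗ[k] W →ₗ[k] W →ₗ[k] k :=
  (T.compl₁₂ φ φ).compr₂ φ.dualMap

@[simp] lemma pull_apply {V W : Type*} [AddCommGroup V] [Module k V] [AddCommGroup W] [Module k W]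
    (T : V →ₗ[k] V →ₗ[k] V →ₗ[k] k) (φ : W →ₗ[k] V) (x y z : W) :
    pull T φ x y z = T (φ x) (φ y) (φ z) := by simp [pull]

/-- difference of trilinear forms -/
noncomputable def tsub {W : Type*} [AddCommGroup W] [Module k W]
    (T S : W →ₗ[k] W →ₗ[k] W →ₗ[k] k) : W →ₗ[k] W →ₗ[k] W →ₗ[k] k := T + (-1 : k) • S

@[simp] lemma tsub_apply {W : Type*} [AddCommGroup W] [Module k W]
    (T S : W →ₗ[k] W →ₗ[k] W →ₗ[k] k) (x y z : W) : tsub T S x y z = T x y z - S x y z := by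
  simp [tsub, sub_eq_add_neg]

lemma polarize {W : Type*} [AddCommGroup W] [Module k W] (hk2 : (2 : k) ≠ 0) (hk3 : (3 : k) ≠ 0)
    (T S : W →ₗ[k] W →ₗ[k] W →ₗ[k] k)
    (hT1 : ∀ x y z, T x y z = T y x z) (hT2 : ∀ x y z, T x y z = T x z y)
    (hS1 : ∀ x y z, S x y z = S y x z) (hS2 : ∀ x y z, S x y z = S x z y)
    (h : ∀ x, T x x x = S x x x) (x y z : W) : T x y z = S x y z := by
  let D : W →ₗ[k] W →ₗ[k] W →ₗ[k] k := tsub T S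
  have hD1 : ∀ x y z, D x y z = D y x z := fun x y z => by simp [D, hT1 x y z, hS1 x y z]
  have hD2 : ∀ x y z, D x y z = D x z y := fun x y z => by simp [D, hT2 x y z, hS2 x y z]
  have hD : ∀ x, D x x x = 0 := fun x => by simp [D, h]
  have e1 := hD (x + y + z)
  have e2 := hD (x + y)
  have e3 := hD (x + z)
  have e4 := hD (y + z)
  have e5 := hD x
  have e6 := hD y
  have e7 := hD z
  simp only [map_add, LinearMap.add_apply] at e1 e2 e3 e4
  have p1 := hD1 x y z
  have p2 := hD2 x y z
  have p3 : D y z x = D x y z := by rw [hD2, hD1]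
  have p4 : D z x y = D x y z := by rw [hD1, hD2]
  have p5 : D z y x = D x y z := by rw [hD1, hD2, hD1]
  have key : (2 * 3) * D x y z = 0 := by
    linear_combination e1 - e2 - e3 - e4 + e5 + e6 + e7 + p1 + p2 - p3 - p4 - p5
  have : D x y z = 0 := by simpa [hk2, hk3] using key
  simpa [D, sub_eq_zero] using this

variable {V : Type*} [AddCommGroup V] [Module k V]

lemma expand {ι : Type*} (T : V →ₗ[k] V →ₗ[k] V →ₗ[k] k)
    (hT1 : ∀ x y z, T x y z = T y x z) (hT2 : ∀ x y z, T x y z = T x z y)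
    (p : V) (Y : ι → V) (h1 : ∀ j, T p p (Y j) = 0) (h2 : ∀ i j, i ≠ j → T p (Y i) (Y j) = 0)
    (h3 : ∀ i j l, ¬ (i = j ∧ j = l) → T (Y i) (Y j) (Y l) = 0) (η : ι → k) (J : Finset ι) :
    T (p + ∑ j ∈ J, η j • Y j) (p + ∑ j ∈ J, η j • Y j) (p + ∑ j ∈ J, η j • Y j) =
    T p p p + ∑ j ∈ J, (3 * η j ^ 2 * T p (Y j) (Y j) + η j ^ 3 * T (Y j) (Y j) (Y j)) := by
  classical
  induction J using Finset.induction_on with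
  | empty => simp
  | insert i s hi ih =>
    rw [Finset.sum_insert hi, Finset.sum_insert hi, ← add_assoc, add_right_comm p]
    have a1 : T p (∑ j ∈ s, η j • Y j) (Y i) = 0 := by
      simp only [map_sum, LinearMap.sum_apply, map_smul, LinearMap.smul_apply]
      exact Finset.sum_eq_zero fun j hj => by rw [h2 j i (by rintro rfl; exact hi hj)]; simp
    have a2 : T (∑ j ∈ s, η j • Y j) (∑ j ∈ s, η j • Y j) (Y i) = 0 := by
      simp only [map_sum, LinearMap.sum_apply, map_smul, LinearMap.smul_apply]
      refine Finset.sum_eq_zero fun j hj => ?_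
      rw [Finset.sum_eq_zero fun l hl => ?_, smul_zero]
      rw [h3, smul_zero]
      rintro ⟨rfl, rfl⟩; exact hi hj
    have a3 : T (∑ j ∈ s, η j • Y j) (Y i) (Y i) = 0 := by
      simp only [map_sum, LinearMap.sum_apply, map_smul, LinearMap.smul_apply]
      exact Finset.sum_eq_zero fun j hj => by
        rw [h3 j i i (by rintro ⟨rfl, -⟩; exact hi hj)]; simp
    generalize ∑ j ∈ s, η j • Y j = y at *
    have b1 : T (p + y) (p + y) (Y i) = 0 := by
      simp only [map_add, LinearMap.add_apply]
      rw [hT1 y p, a1, a2, h1]; simp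
    have b2 : T (p + y) (Y i) (Y i) = T p (Y i) (Y i) := by
      simp [a3]
    generalize p + y = u at *
    simp only [map_add, LinearMap.add_apply, map_smul, LinearMap.smul_apply, smul_eq_mul]
    rw [hT2 (Y i) (Y i) u, hT1 (Y i) u u, hT2 u (Y i) u, hT1 (Y i) u (Y i), b1, b2, ih]
    ring

lemma source_embed [IsAlgClosed k] (hk2 : (2 : k) ≠ 0) (hk3 : (3 : k) ≠ 0)
    (T : V →ₗ[k] V →ₗ[k] V →ₗ[k] k)
    (hT1 : ∀ x y z, T x y z = T y x z) (hT2 : ∀ x y z, T x y z = T x z y)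
    (A : ℕ → Prop) (X : ℕ → V) (Y : ℕ × ℕ × Fin 4 → V) (hM : IsModel T A X Y)
    (S : (ℕ →₀ k) →ₗ[k] (ℕ →₀ k) →ₗ[k] (ℕ →₀ k) →ₗ[k] k)
    (hS1 : ∀ x y z, S x y z = S y x z) (hS2 : ∀ x y z, S x y z = S x z y)
    (hSA : ∀ a, ¬ A a → Finsupp.single a 1 ∈ KK S) :
    ∃ φ : (ℕ →₀ k) →ₗ[k] V, ∀ w, T (φ w) (φ w) (φ w) = S w w w := by
  classical
  obtain ⟨M1, M2, M3, M4, M5, M6, M7, M8⟩ := hM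
  let ψ : (ℕ →₀ k) →ₗ[k] V := Finsupp.linearCombination k X
  have hψ : ∀ a, ψ (Finsupp.single a 1) = X a := fun a => by simp [ψ]
  let H : (ℕ →₀ k) →ₗ[k] (ℕ →₀ k) →ₗ[k] (ℕ →₀ k) →ₗ[k] k := tsub S (pull T ψ)
  have hH1 : ∀ x y z, H x y z = H y x z := fun x y z => by
    simp [H, hS1 x y z, hT1 (ψ x) (ψ y) (ψ z)]
  have hH2 : ∀ x y z, H x y z = H x z y := fun x y z => by
    simp [H, hS2 x y z, hT2 (ψ x) (ψ y) (ψ z)]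
  have hHA : ∀ a, ¬ A a → Finsupp.single a 1 ∈ KK H := by
    intro a ha
    have h := hSA a ha
    rw [mem_KK] at h ⊢
    obtain ⟨n, l, m, h⟩ := h
    refine ⟨n, l, m, fun x => ?_⟩
    rw [← h x]
    simp [H, hψ, M1 a ha]
  choose l m hl hsum hN using source_decomp H hH2
  choose N0 hN0 using fun a (ha : ¬ A a) => hN a (hHA a ha)
  obtain ⟨i, hi⟩ := IsAlgClosed.exists_pow_nat_eq (-1 : k) (n := 2) (by norm_num)
  obtain ⟨κ, hκ⟩ := IsAlgClosed.exists_pow_nat_eq ((2 * 2 * 3 : k)⁻¹) (n := 2) (by norm_num)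
  obtain ⟨θ, hθ⟩ := IsAlgClosed.exists_pow_nat_eq ((2 * 2 * 2 * 3 : k)⁻¹) (n := 3) (by norm_num)
  have hκ' : 12 * κ ^ 2 = 1 := by
    rw [hκ]; have : (12 : k) = 2 * 2 * 3 := by norm_num
    rw [this]; field_simp
  have hθ' : 24 * θ ^ 3 = 1 := by
    rw [hθ]; have : (24 : k) = 2 * 2 * 2 * 3 := by norm_num
    rw [this]; field_simp
  let x : ℕ → (ℕ →₀ k) →ₗ[k] k := fun a => Finsupp.lapply a
  let η : ℕ × ℕ × Fin 4 → (ℕ →₀ k) →ₗ[k] k := fun j =>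
    if ha : A j.1 then
      (![κ • (l j.1 j.2.1 + m j.1 j.2.1), (i * κ) • (l j.1 j.2.1 - m j.1 j.2.1), 0, 0] :
        Fin 4 → (ℕ →₀ k) →ₗ[k] k) j.2.2
    else if j.2.1 < N0 j.1 ha then
      (![θ • (x j.1 + l j.1 j.2.1 + m j.1 j.2.1), θ • (x j.1 - l j.1 j.2.1 - m j.1 j.2.1),
        θ • (-x j.1 + l j.1 j.2.1 - m j.1 j.2.1), θ • (-x j.1 - l j.1 j.2.1 + m j.1 j.2.1)] :
        Fin 4 → (ℕ →₀ k) →ₗ[k] k) j.2.2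
    else 0
  -- vanishing
  have hη0 : ∀ a b ε w, l a b w = 0 → m a b w = 0 →
      ((∀ ha : ¬ A a, b < N0 a ha → w a = 0)) → η (a, b, ε) w = 0 := by
    intro a b ε w h1 h2 h3
    simp only [η]
    split_ifs with ha hb
    · fin_cases ε <;> simp [h1, h2]
    · have := h3 ha hb
      fin_cases ε <;> simp [h1, h2, x, this]
    · simp
  have hbox : ∀ w : ℕ →₀ k, ∃ N M, (∀ n, N ≤ n → w n = 0) ∧
      (∀ a < N, ∑ b ∈ Finset.range M, l a b w * m a b w =
        3 * H (Finsupp.single a 1) (tl a w) (tl a w) +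
      w a * (w a * H (Finsupp.single a 1) (Finsupp.single a 1) (Finsupp.single a 1) -
        3 * H (Finsupp.single a 1) (Finsupp.single a 1) (tl a w))) ∧
      (∀ j ∉ Finset.range N ×ˢ Finset.range M ×ˢ (Finset.univ : Finset (Fin 4)), η j w = 0) := by
    intro w
    obtain ⟨N, hNw⟩ := exists_bound w
    choose M0 hM0 using fun a => hsum a w
    let M := (Finset.range N).sup fun a => M0 a + if ha : ¬ A a then N0 a ha else 0
    have hMle : ∀ a < N, M0 a + (if ha : ¬ A a then N0 a ha else 0) ≤ M := fun a ha =>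
      Finset.le_sup (f := fun a => M0 a + if ha : ¬ A a then N0 a ha else 0) (Finset.mem_range.2 ha)
    refine ⟨N, M, hNw, fun a ha => ?_, ?_⟩
    · exact (hM0 a M (by have := hMle a ha; omega)).2.2
    · rintro ⟨a, b, ε⟩ hj
      simp only [Finset.mem_product, Finset.mem_range, Finset.mem_univ, and_true, not_and,
        not_lt] at hj
      by_cases ha : a < N
      · have hb := hj ha
        have h1 := hMle a ha
        have h2 := hM0 a b (by omega)
        refine hη0 a b ε w h2.1 h2.2.1 fun hA hbN => ?_
        rw [dif_pos hA] at h1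
        omega
      · have ha' : N ≤ a := by omega
        have h1 := hl a w (tl_eq_zero fun n hn => hNw n (by omega)) b
        exact hη0 a b ε w h1.1 h1.2 fun _ _ => hNw a ha'
  have hfin : ∀ w, (Function.support fun j => η j w).Finite := by
    intro w
    obtain ⟨N, M, -, -, h⟩ := hbox w
    refine Set.Finite.subset (Finset.finite_toSet
      (Finset.range N ×ˢ Finset.range M ×ˢ (Finset.univ : Finset (Fin 4)))) ?_
    intro j hj
    by_contra hc
    exact hj (h j hc)
  let Φ : (ℕ →₀ k) →ₗ[k] (ℕ × ℕ × Fin 4 →₀ k) :=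
    { toFun := fun w => Finsupp.ofSupportFinite (fun j => η j w) (hfin w)
      map_add' := fun u v => by ext j; simp [Finsupp.ofSupportFinite_coe]
      map_smul' := fun c v => by ext j; simp [Finsupp.ofSupportFinite_coe] }
  have hΦ : ∀ w j, Φ w j = η j w := fun w j => rfl
  refine ⟨ψ + Finsupp.linearCombination k Y ∘ₗ Φ, fun w => ?_⟩
  obtain ⟨N, M, hNw, hg, hJ⟩ := hbox w
  have hφ : (ψ + Finsupp.linearCombination k Y ∘ₗ Φ) w = ψ w +
      ∑ j ∈ Finset.range N ×ˢ Finset.range M ×ˢ (Finset.univ : Finset (Fin 4)), η j w • Y j := by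
    rw [LinearMap.add_apply, LinearMap.comp_apply, Finsupp.linearCombination_apply k (Φ w),
      Finsupp.sum_of_support_subset (s := Finset.range N ×ˢ Finset.range M ×ˢ
        (Finset.univ : Finset (Fin 4)))]
    · rfl
    · intro j hj
      by_contra hc
      exact (Finsupp.mem_support_iff.1 hj) (hJ j hc)
    · intros; simp
  have hψs : ψ w = ∑ a ∈ w.support, w a • X a := by
    simp [ψ, Finsupp.linearCombination_apply, Finsupp.sum]
  have hp1 : ∀ j, T (ψ w) (ψ w) (Y j) = 0 := by
    intro j
    rw [hψs]
    simp only [map_sum, LinearMap.sum_apply, map_smul, LinearMap.smul_apply, M2, smul_zero,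
      Finset.sum_const_zero]
  have hp2 : ∀ i j, i ≠ j → T (ψ w) (Y i) (Y j) = 0 := by
    intro i j hij
    rw [hψs]
    simp only [map_sum, LinearMap.sum_apply, map_smul, LinearMap.smul_apply, M3 _ i j hij, smul_zero,
      Finset.sum_const_zero]
  have hp3 : ∀ j, T (ψ w) (Y j) (Y j) = if A j.1 then w j.1 else 0 := by
    intro j
    rw [hψs]
    simp only [map_sum, LinearMap.sum_apply, map_smul, LinearMap.smul_apply]
    rw [Finset.sum_eq_single j.1]
    · split_ifs with h
      · rw [M4 _ j h rfl]; simp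
      · rw [M1 _ h]; simp
    · intro b _ hb
      rw [M5 b j hb.symm, smul_zero]
    · intro h
      rw [Finsupp.notMem_support_iff.1 h, zero_smul]
  rw [hφ, expand T hT1 hT2 (ψ w) Y hp1 hp2 M6 (fun j => η j w)]
  have hfinal : ∑ j ∈ Finset.range N ×ˢ Finset.range M ×ˢ (Finset.univ : Finset (Fin 4)),
      (3 * η j w ^ 2 * T (ψ w) (Y j) (Y j) + η j w ^ 3 * T (Y j) (Y j) (Y j)) = H w w w := by
    rw [tele3 H hH1 hH2 w N, tl_eq_zero hNw, Finset.sum_product]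
    simp only [map_zero, add_zero]
    refine Finset.sum_congr rfl fun a ha => ?_
    rw [← hg a (Finset.mem_range.1 ha), Finset.sum_product, Finset.mul_sum]
    refine Finset.sum_congr rfl fun b _ => ?_
    by_cases hA : A a
    · have hd : ∀ ε, T (Y (a, b, ε)) (Y (a, b, ε)) (Y (a, b, ε)) = 0 := fun ε => M7 _ hA
      simp only [hd, hp3, if_pos hA, mul_zero, add_zero, η, dif_pos hA, Fin.sum_univ_four]
      simp
      linear_combination (w a) * (l a b w * m a b w) * hκ' +
        3 * (w a) * κ ^ 2 * (l a b w - m a b w) ^ 2 * hi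
    · have hd : ∀ ε, T (Y (a, b, ε)) (Y (a, b, ε)) (Y (a, b, ε)) = 1 := fun ε => M8 _ hA
      by_cases hb : b < N0 a hA
      · simp only [hd, hp3, if_neg hA, mul_zero, zero_add, mul_one, η, dif_neg hA, if_pos hb,
          Fin.sum_univ_four]
        simp [x]
        linear_combination (w a) * (l a b w * m a b w) * hθ'
      · simp only [hd, hp3, if_neg hA, mul_zero, zero_add, mul_one, η, dif_neg hA, if_neg hb]
        rw [(hN0 a hA b (by omega)).1]
        simp
  rw [hfinal]
  simp [H]

end Source

section Final

universe u₀ v₀ w₀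

variable {k : Type u₀} {V : Type v₀} {W : Type w₀} [Field k] [AddCommGroup V] [Module k V]
  [AddCommGroup W] [Module k W]

lemma rrk_le_iff (T : V →ₗ[k] V →ₗ[k] V →ₗ[k] k) (S : W →ₗ[k] W →ₗ[k] W →ₗ[k] k) :
    Cardinal.lift.{v₀} (rrk k S) ≤ Cardinal.lift.{w₀} (rrk k T) ↔
    Cardinal.lift.{v₀} (Module.rank k (W ⧸ KK S)) ≤
      Cardinal.lift.{w₀} (Module.rank k (V ⧸ KK T)) := by
  rw [rrk_eq, rrk_eq, ← Cardinal.lift_le.{u₀} (a := Cardinal.lift.{v₀} (Module.rank k (W ⧸ KK S)))]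
  simp only [Cardinal.lift_lift]

lemma KK_pull (S : W →ₗ[k] W →ₗ[k] W →ₗ[k] k) {E : Type*} [AddCommGroup E] [Module k E]
    (p : E →ₗ[k] W) (x : E) (hx : p x ∈ KK S) : x ∈ KK (pull S p) := by
  rw [mem_KK] at hx ⊢
  obtain ⟨n, l, m, h⟩ := hx
  exact ⟨n, fun i => l i ∘ₗ p, fun i => m i ∘ₗ p, fun y => by simpa using h (p y)⟩

lemma rank_le_of_embed (T : V →ₗ[k] V →ₗ[k] V →ₗ[k] k) (φ : W →ₗ[k] V) :
    Cardinal.lift.{v₀} (Module.rank k (W ⧸ KK (pull T φ))) ≤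
      Cardinal.lift.{w₀} (Module.rank k (V ⧸ KK T)) := by
  have hle : (KK T).comap φ ≤ KK (pull T φ) := fun x hx => KK_pull T φ x hx
  have h1 : Module.rank k (W ⧸ KK (pull T φ)) ≤ Module.rank k (W ⧸ (KK T).comap φ) :=
    LinearMap.rank_le_of_surjective _ (Submodule.factor_surjective hle)
  refine (Cardinal.lift_le.2 h1).trans ?_
  refine LinearMap.lift_rank_le_of_injective (Submodule.mapQ _ (KK T) φ le_rfl) ?_
  rw [← LinearMap.ker_eq_bot, Submodule.ker_mapQ]
  simp

lemma exists_span (hW : Module.rank k W ≤ Cardinal.aleph0) :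
    ∃ e : ℕ → W, Submodule.span k (Set.range e) = ⊤ := by
  let b := Module.Basis.ofVectorSpace k W
  have hc : (Set.range b).Countable := by
    rw [← Cardinal.le_aleph0_iff_set_countable]
    rw [← b.mk_range_eq_rank] at hW
    exact hW
  obtain ⟨e, he⟩ := (hc.insert 0).exists_eq_range (Set.insert_nonempty _ _)
  refine ⟨e, ?_⟩
  rw [← he, Submodule.span_insert_zero, b.span_eq]

lemma embed_of_span [IsAlgClosed k] (hk2 : (2 : k) ≠ 0) (hk3 : (3 : k) ≠ 0)
    (T : V →ₗ[k] V →ₗ[k] V →ₗ[k] k)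
    (hT1 : ∀ x y z, T x y z = T y x z) (hT2 : ∀ x y z, T x y z = T x z y)
    (S : W →ₗ[k] W →ₗ[k] W →ₗ[k] k)
    (hS1 : ∀ x y z, S x y z = S y x z) (hS2 : ∀ x y z, S x y z = S x z y)
    (A : ℕ → Prop) (X : ℕ → V) (Y : ℕ × ℕ × Fin 4 → V) (hM : IsModel T A X Y)
    (e : ℕ → W) (he : Submodule.span k (Set.range e) = ⊤) (heA : ∀ a, ¬ A a → e a ∈ KK S) :
    ∃ φ : W →ₗ[k] V, ∀ x y z, T (φ x) (φ y) (φ z) = S x y z := by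
  let p : (ℕ →₀ k) →ₗ[k] W := Finsupp.linearCombination k e
  have hp : LinearMap.range p = ⊤ := by rw [Finsupp.range_linearCombination, he]
  obtain ⟨σ, hσ⟩ := p.exists_rightInverse_of_surjective hp
  obtain ⟨φ, hφ⟩ := source_embed hk2 hk3 T hT1 hT2 A X Y hM (pull S p)
    (fun x y z => by simp [hS1 (p x)]) (fun x y z => by simp [hS2 (p x) (p y)])
    (fun a ha => KK_pull S p _ (by simpa [p] using heA a ha))
  refine ⟨φ ∘ₗ σ, fun x y z => ?_⟩
  have := polarize hk2 hk3 (pull T (φ ∘ₗ σ)) S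
    (fun x y z => by simp [hT1 (φ (σ x))]) (fun x y z => by simp [hT2 (φ (σ x)) (φ (σ y))])
    hS1 hS2 (fun x => by
      have h1 := hφ (σ x)
      have h2 : p (σ x) = x := LinearMap.congr_fun hσ x
      simpa [h2] using h1) x y z
  simpa using this

lemma exists_span_fin (S : W →ₗ[k] W →ₗ[k] W →ₗ[k] k)
    (hW : Module.rank k W ≤ Cardinal.aleph0) (r : ℕ) (hr : Module.rank k (W ⧸ KK S) ≤ r) :
    ∃ e : ℕ → W, Submodule.span k (Set.range e) = ⊤ ∧ ∀ a, ¬ a < r → e a ∈ KK S := by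
  have hfin : Module.Finite k (W ⧸ KK S) :=
    Module.rank_lt_aleph0_iff.1 (hr.trans_lt (Cardinal.natCast_lt_aleph0))
  have hs : Module.finrank k (W ⧸ KK S) ≤ r := by
    rw [← Module.finrank_eq_rank] at hr
    exact_mod_cast hr
  let b := Module.finBasis k (W ⧸ KK S)
  choose c hc using fun i => (KK S).mkQ_surjective (b i)
  obtain ⟨e', he'⟩ := exists_span (k := k) (W := KK S) ((Submodule.rank_le _).trans hW)
  let e : ℕ → W := fun a => if h : a < Module.finrank k (W ⧸ KK S) then c ⟨a, h⟩ else
    if a < r then 0 else (e' (a - r) : W)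
  refine ⟨e, ?_, fun a ha => ?_⟩
  · have h1 : KK S ≤ Submodule.span k (Set.range e) := by
      have : KK S = Submodule.span k (Set.range fun a => (e' a : W)) := by
        have h := congrArg (Submodule.map (KK S).subtype) he'
        rw [Submodule.map_span, ← Set.range_comp, Submodule.map_subtype_top] at h
        exact h.symm
      rw [this]
      apply Submodule.span_mono
      rintro _ ⟨a, rfl⟩
      refine ⟨a + r, ?_⟩
      simp only [e]
      rw [dif_neg (by omega), if_neg (by omega), Nat.add_sub_cancel]
    have h2 : Submodule.map (KK S).mkQ (Submodule.span k (Set.range e)) = ⊤ := by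
      rw [eq_top_iff, ← b.span_eq, Submodule.span_le]
      rintro _ ⟨i, rfl⟩
      refine ⟨c i, Submodule.subset_span ⟨i, ?_⟩, hc i⟩
      simp [e]
    have h3 := congrArg (Submodule.comap (KK S).mkQ) h2
    rw [Submodule.comap_map_mkQ, Submodule.comap_top, sup_eq_right.2 h1] at h3
    exact h3
  · simp only [e]
    rw [dif_neg (by omega), if_neg ha]
    exact (e' _).2

end Final

/-- Let `(V,T)` be a non-degenerate cubic space over an algebraically
closed field `k` of characteristic `≠ 2, 3`, and let `(W,S)` be a cubic space with
`dim_k W ≤ ℵ₀`. Then `W` embeds into `V` as a cubic space iff `rrk(W,S) ≤ rrk(V,T)`. -/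
theorem cubic_embedding_iff_rrk_le
    {k : Type u} {V : Type v} {W : Type w} [Field k] [IsAlgClosed k]
    (hk2 : (2 : k) ≠ 0) (hk3 : (3 : k) ≠ 0)
    [AddCommGroup V] [Module k V] [AddCommGroup W] [Module k W]
    (T : V →ₗ[k] V →ₗ[k] V →ₗ[k] k)
    (hT1 : ∀ x y z, T x y z = T y x z) (hT2 : ∀ x y z, T x y z = T x z y)
    (hV : ¬ FiniteStrengthCubic k T)
    (S : W →ₗ[k] W →ₗ[k] W →ₗ[k] k)
    (hS1 : ∀ x y z, S x y z = S y x z) (hS2 : ∀ x y z, S x y z = S x z y)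
    (hW : Module.rank k W ≤ Cardinal.aleph0) :
    (∃ φ : W →ₗ[k] V, ∀ x y z, T (φ x) (φ y) (φ z) = S x y z) ↔
      Cardinal.lift.{v} (rrk k S) ≤ Cardinal.lift.{w} (rrk k T) := by
  rw [rrk_le_iff]
  constructor
  · rintro ⟨φ, hφ⟩
    have : S = pull T φ := by
      ext x y z
      simp [hφ]
    rw [this]
    exact rank_le_of_embed T φ
  · intro h
    by_cases hK : FC (KK T)
    · obtain ⟨X, Y, hM⟩ := finModel T hk2 hk3 hT1 hT2 hV hK
      have hK' : Module.Finite k (V ⧸ KK T) := hK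
      have hr : Module.rank k (W ⧸ KK S) ≤ (Module.finrank k (V ⧸ KK T) : ℕ) := by
        rw [← Module.finrank_eq_rank k (V ⧸ KK T), Cardinal.lift_natCast] at h
        simpa using h
      obtain ⟨e, he, heA⟩ := exists_span_fin S hW _ hr
      exact embed_of_span hk2 hk3 T hT1 hT2 S hS1 hS2 _ X Y hM e he heA
    · obtain ⟨X, Y, hM⟩ := infModel T hk2 hk3 hT1 hT2 hK
      obtain ⟨e, he⟩ := exists_span (k := k) (W := W) hW
      exact embed_of_span hk2 hk3 T hT1 hT2 S hS1 hS2 _ X Y hM e he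
        (fun a ha => absurd trivial ha)
end

section
/- Let (V,T) be a non-degenerate cubic space over k with cubic form F(x) = T(x,x,x). Let q_1,…,q_r be quadratic forms on V of infinite collective strength, let q'_1,…,q'_s be quadratic forms on V each of finite strength, and let ℓ_1,…,ℓ_t be linear forms on V. Then for any elements a, b_1,…,b_r of k there exists v ∈ V such that F(v) = a, q_i(v) = b_i for all 1 ≤ i ≤ r, q'_j(v) = 0 for all 1 ≤ j ≤ s, and ℓ_j(v) = 0 for all 1 ≤ j ≤ t. -/
open scoped BigOperators

theorem aux_decomp {k V : Type*} [Field k] [AddCommGroup V] [Module k V]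
    {W : Submodule k V} (hW : W.CoFG) :
    ∃ (n : ℕ) (l : Fin n → V →ₗ[k] k) (c : Fin n → V), ∀ x, x - ∑ i, l i x • c i ∈ W := by
  obtain ⟨σ, hσ⟩ := W.mkQ.exists_rightInverse_of_surjective W.range_mkQ
  have : Module.Finite k (V ⧸ W) := hW
  let bs := Module.finBasis k (V ⧸ W)
  refine ⟨_, fun i => (bs.coord i).comp W.mkQ, fun i => σ (bs i), fun x => ?_⟩
  have h1 : ∑ i, ((bs.coord i).comp W.mkQ) x • σ (bs i) = σ (W.mkQ x) := by
    conv_rhs => rw [← bs.sum_repr (W.mkQ x), map_sum]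
    simp only [map_smul]
    rfl
  rw [h1, ← Submodule.Quotient.mk_eq_zero, Submodule.Quotient.mk_sub, sub_eq_zero]
  exact (LinearMap.congr_fun hσ (W.mkQ x)).symm

theorem aux_quad_fin {k V : Type*} [Field k] [AddCommGroup V] [Module k V] (hk2 : (2 : k) ≠ 0)
    {W : Submodule k V} (hW : W.CoFG) (q : QuadraticForm k V) (h : ∀ x ∈ W, q x = 0) :
    q ∈ FinStrength k V := by
  obtain ⟨n, l, c, hl⟩ := aux_decomp hW
  have : Invertible (2 : k) := invertibleOfNonzero hk2
  obtain ⟨B, hB, hs⟩ : ∃ B : V →ₗ[k] V →ₗ[k] k, (∀ x, q x = B x x) ∧ ∀ x y, B x y = B y x :=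
    ⟨QuadraticMap.associated q, fun x => (QuadraticMap.associated_eq_self_apply k q x).symm,
      fun x y => QuadraticMap.associated_isSymm k q x y⟩
  let p : V →ₗ[k] V := ∑ i, (l i).smulRight (c i)
  have hp : ∀ x, p x = ∑ i, l i x • c i := fun x => by simp [p]
  refine ⟨n, l, fun i => B (c i) + (B (c i)).comp (LinearMap.id - p), fun x => ?_⟩
  have h0 := h _ (hl x)
  rw [← hp, hB] at h0
  have h1 : ∀ y, B (p x) y = ∑ i, l i x * B (c i) y := fun y => by simp [hp]
  have h2 : ∑ i, l i x * (B (c i) + (B (c i)).comp (LinearMap.id - p) : V →ₗ[k] k) x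
      = B (p x) x + B (p x) (x - p x) := by
    rw [h1, h1, ← Finset.sum_add_distrib]
    simp [mul_add]
  rw [h2, hB]
  have := hs x (p x)
  simp only [map_sub, LinearMap.sub_apply] at h0 ⊢
  linear_combination h0 + this

theorem aux_cubic_fin {k V : Type*} [Field k] [AddCommGroup V] [Module k V]
    (T : V →ₗ[k] V →ₗ[k] V →ₗ[k] k)
    (hT1 : ∀ x y z, T x y z = T y x z) (hT2 : ∀ x y z, T x y z = T x z y)
    {W : Submodule k V} (hW : W.CoFG) (h : ∀ x ∈ W, T x x x = 0) :
    FiniteStrengthCubic k T := by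
  obtain ⟨n, l, c, hl⟩ := aux_decomp hW
  let p : V →ₗ[k] V := ∑ i, (l i).smulRight (c i)
  have hp : ∀ x, p x = ∑ i, l i x • c i := fun x => by simp [p]
  let y : V →ₗ[k] V := LinearMap.id - p
  refine ⟨n, l, fun i => LinearMap.BilinMap.toQuadraticMap
    (T (c i) + (T (c i)).comp y + ((T (c i)).comp y).compl₂ y), fun x => ?_⟩
  have h0 := h _ (hl x)
  rw [← hp] at h0
  have h1 : ∀ u v, T (p x) u v = ∑ i, l i x * T (c i) u v := fun u v => by simp [hp]
  have h2 : ∑ i, l i x * (LinearMap.BilinMap.toQuadraticMap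
    (T (c i) + (T (c i)).comp y + ((T (c i)).comp y).compl₂ y)) x
      = T (p x) x x + T (p x) (y x) x + T (p x) (y x) (y x) := by
    rw [h1, h1, h1, ← Finset.sum_add_distrib, ← Finset.sum_add_distrib]
    simp [mul_add]
  rw [h2]
  have e1 := hT1 x (p x) x
  have e2 := hT2 x x (p x)
  have e3 := hT2 x (p x) (p x)
  have e4 := hT1 x (p x) (p x)
  have e5 := hT2 (p x) x (p x)
  simp only [y, map_sub, LinearMap.sub_apply, LinearMap.id_apply] at h0 ⊢
  linear_combination h0 + 2 * e1 + e2 - e4 - e5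

theorem aux_fin_vanish {k V : Type*} [Field k] [AddCommGroup V] [Module k V]
    {q : QuadraticForm k V} (h : q ∈ FinStrength k V) :
    ∃ W : Submodule k V, W.CoFG ∧ ∀ x ∈ W, q x = 0 := by
  obtain ⟨n, l, m, h⟩ := h
  refine ⟨LinearMap.ker (LinearMap.pi l), Submodule.CoFG.ker _, fun x hx => ?_⟩
  rw [h]
  refine Finset.sum_eq_zero fun i _ => ?_
  have : l i x = 0 := congrFun hx i
  simp [this]

theorem aux_iInf {k V ι : Type*} [Field k] [AddCommGroup V] [Module k V] [Finite ι]
    (W : ι → Submodule k V) (hW : ∀ i, (W i).CoFG) : (⨅ i, W i).CoFG :=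
  Submodule.CoFG.sInf_of_finite (Set.finite_range W) (by rintro _ ⟨i, rfl⟩; exact hW i)

theorem aux_orth {k V ι : Type*} [Field k] [AddCommGroup V] [Module k V] [Fintype ι]
    (q : ι → QuadraticForm k V) {U : Submodule k V} (hU : U.FG) :
    ∃ W : Submodule k V, W.CoFG ∧ ∀ v ∈ W, ∀ u ∈ U, ∀ i, QuadraticMap.polar (q i) u v = 0 := by
  have : Module.Finite k U := Module.Finite.iff_fg.mpr hU
  refine ⟨LinearMap.ker (LinearMap.pi fun i =>
    (((q i).polarBilin).domRestrict U).flip), Submodule.CoFG.ker _, fun v hv u hu i => ?_⟩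
  have := LinearMap.congr_fun (congrFun hv i) ⟨u, hu⟩
  simpa using this

theorem aux_quad_smul_add {k V : Type*} [Field k] [AddCommGroup V] [Module k V]
    (q : QuadraticForm k V) (u v : V) (x : k) (h : QuadraticMap.polar q u v = 0) :
    q (u + x • v) = q u + x * x * q v := by
  rw [QuadraticMap.map_add (⇑q), QuadraticMap.polar_smul_right, h, QuadraticMap.map_smul]
  simp

theorem aux_quadrics {k V ι : Type*} [Field k] [IsAlgClosed k] (hk2 : (2 : k) ≠ 0)
    [AddCommGroup V] [Module k V] [Fintype ι] (q : ι → QuadraticForm k V)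
    (hq : ∀ c : ι → k, c ≠ 0 → (∑ i, c i • q i) ∉ FinStrength k V)
    {W : Submodule k V} (hW : W.CoFG) (b : ι → k) : ∃ w ∈ W, ∀ i, q i w = b i := by
  classical
  have key : ∀ d, d ≤ Fintype.card ι → ∃ (U : Submodule k V) (S : Submodule k (ι → k)), U.FG ∧
      U ≤ W ∧ d ≤ Module.finrank k S ∧ ∀ b ∈ S, ∃ w ∈ U, ∀ i, q i w = b i := by
    intro d
    induction d with
    | zero =>
      refine fun _ => ⟨⊥, ⊥, Submodule.fg_bot, bot_le, Nat.zero_le _, fun b hb => ⟨0, zero_mem _, ?_⟩⟩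
      rw [Submodule.mem_bot] at hb
      simp [hb]
    | succ d ih =>
      intro hd
      obtain ⟨U, S, hU, hUW, hdS, hS⟩ := ih (by omega)
      by_cases hS' : S = ⊤
      · refine ⟨U, S, hU, hUW, ?_, hS⟩
        rw [hS']; simpa using hd
      obtain ⟨W', hW', ho⟩ := aux_orth q hU
      obtain ⟨f, hf0, hf⟩ := Submodule.exists_le_ker_of_lt_top S (lt_top_iff_ne_top.mpr hS')
      have hfe : ∀ z : ι → k, f z = ∑ i, f (Pi.single i 1) * z i := by
        intro z
        conv_lhs => rw [pi_eq_sum_univ' z]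
        simp [map_sum, mul_comm]
      have hne : (fun i => f (Pi.single i 1)) ≠ 0 := by
        intro h
        apply hf0
        ext i
        simpa using congrFun h i
      have : ∃ v ∈ W ⊓ W', f (fun i => q i v) ≠ 0 := by
        by_contra! hcon
        refine hq _ hne (aux_quad_fin hk2 (hW.inf hW') _ fun x hx => ?_)
        have := hcon x hx
        rw [hfe] at this
        simpa [sum_apply] using this
      obtain ⟨v, hv, hfv⟩ := this
      have hpS : (fun i => q i v) ∉ S := fun h => hfv (hf h)
      refine ⟨U ⊔ Submodule.span k {v}, S ⊔ Submodule.span k {fun i => q i v},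
        hU.sup (Submodule.fg_span_singleton v), sup_le hUW ?_, ?_, ?_⟩
      · rw [Submodule.span_singleton_le_iff_mem]; exact hv.1
      · refine lt_of_le_of_lt hdS (Submodule.finrank_lt_finrank_of_lt ?_)
        refine lt_of_le_of_ne le_sup_left fun h => hpS ?_
        rw [h]
        exact Submodule.mem_sup_right (Submodule.mem_span_singleton_self _)
      · intro b hb
        obtain ⟨s, hs, _, hz, rfl⟩ := Submodule.mem_sup.mp hb
        obtain ⟨y, rfl⟩ := Submodule.mem_span_singleton.mp hz
        obtain ⟨x, rfl⟩ := IsAlgClosed.exists_eq_mul_self y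
        obtain ⟨w, hw, hws⟩ := hS s hs
        refine ⟨w + x • v, Submodule.add_mem_sup hw
          (Submodule.smul_mem _ _ (Submodule.mem_span_singleton_self _)), fun i => ?_⟩
        rw [aux_quad_smul_add _ _ _ _ (ho v hv.2 w hw i), hws]
        simp
  obtain ⟨U, S, -, hUW, hd, hS⟩ := key _ le_rfl
  have : S = ⊤ := Submodule.eq_top_of_finrank_eq
    (le_antisymm (Submodule.finrank_le S) (by simpa using hd))
  obtain ⟨w, hw, h⟩ := hS b (by simp [this])
  exact ⟨w, hUW hw, h⟩

theorem aux_iso {k V ι α : Type*} [Field k] [IsAlgClosed k]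
    [AddCommGroup V] [Module k V] [Fintype ι] (q : ι → QuadraticForm k V)
    (P : α → V → Prop)
    (base : ∀ a (W : Submodule k V), W.CoFG → ∃ v ∈ W, P a v)
    (step : ∀ a v, P a v → ∃ (a' : α) (W : Submodule k V), W.CoFG ∧
      ∀ w ∈ W, P a' w → ∀ x : k, P a (w + x • v) ∨ P a (w + (-x) • v))
    (s : Finset ι) : ∀ a (W : Submodule k V), W.CoFG → ∃ v ∈ W, P a v ∧ ∀ i ∈ s, q i v = 0 := by
  classical
  induction s using Finset.induction with
  | empty => simpa using base
  | insert j s hj ih =>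
    intro a W hW
    obtain ⟨v, hvW, hPv, hv⟩ := ih a W hW
    by_cases hqv : q j v = 0
    · exact ⟨v, hvW, hPv, by simpa [hqv] using hv⟩
    obtain ⟨a', W', hW', h⟩ := step a v hPv
    obtain ⟨W'', hW'', ho⟩ := aux_orth q (Submodule.fg_span_singleton (R := k) v)
    obtain ⟨w, hwW, hPw, hw⟩ := ih a' (W ⊓ (W' ⊓ W'')) (hW.inf (hW'.inf hW''))
    obtain ⟨x, hx⟩ := IsAlgClosed.exists_eq_mul_self (-(q j w) / q j v)
    have hx' : q j w + x * x * q j v = 0 := by rw [← hx]; field_simp; ring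
    have hpol : ∀ i, QuadraticMap.polar (q i) w v = 0 := fun i => by
      rw [QuadraticMap.polar_comm]
      exact ho w hwW.2.2 v (Submodule.mem_span_singleton_self _) i
    have hz : ∀ y : k, y * y = x * x → ∀ i ∈ insert j s, q i (w + y • v) = 0 := by
      intro y hy i hi
      rw [aux_quad_smul_add _ _ _ _ (hpol i), hy]
      rcases Finset.mem_insert.mp hi with rfl | hi
      · exact hx'
      · simp [hw i hi, hv i hi]
    rcases h w hwW.2.1 hPw x with h | h
    · exact ⟨_, W.add_mem hwW.1 (W.smul_mem _ hvW), h, hz x rfl⟩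
    · exact ⟨_, W.add_mem hwW.1 (W.smul_mem _ hvW), h, hz (-x) (by ring)⟩

theorem aux_cube {k V : Type*} [Field k] [AddCommGroup V] [Module k V]
    (T : V →ₗ[k] V →ₗ[k] V →ₗ[k] k)
    (hT1 : ∀ x y z, T x y z = T y x z) (hT2 : ∀ x y z, T x y z = T x z y)
    (v w : V) (x : k) (h : T v v w = 0) :
    T (w + x • v) (w + x • v) (w + x • v)
      = T w w w + 3 * x * T v w w + x ^ 3 * T v v v := by
  have e1 := hT1 w v w
  have e2 := hT2 w w v
  have e3 := hT1 w v v
  have e4 := hT2 v w v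
  simp only [map_add, map_smul, LinearMap.add_apply, LinearMap.smul_apply, smul_eq_mul]
  linear_combination 2 * x * e1 + x * e2 + x ^ 2 * e3 + 2 * x ^ 2 * e4 + 3 * x ^ 2 * h

/-- There is an isotropic vector for `q` which is useful for the cubic. -/
theorem aux_good {k V ι : Type*} [Field k] [IsAlgClosed k] (hk2 : (2 : k) ≠ 0)
    [AddCommGroup V] [Module k V] [Fintype ι]
    (T : V →ₗ[k] V →ₗ[k] V →ₗ[k] k)
    (hT1 : ∀ x y z, T x y z = T y x z) (hT2 : ∀ x y z, T x y z = T x z y)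
    (hV : ¬ FiniteStrengthCubic k T) (q : ι → QuadraticForm k V)
    (g : V →ₗ[k] (QuadraticForm k V ⧸ FinStrength k V))
    (hg : ∀ v, g v = (FinStrength k V).mkQ (LinearMap.BilinMap.toQuadraticMap (T v)))
    (S : Submodule k (QuadraticForm k V ⧸ FinStrength k V)) (hS : S.FG)
    {W : Submodule k V} (hW : W.CoFG) :
    ∃ v ∈ W, (g v ∉ S ∨ T v v v ≠ 0) ∧ ∀ i, q i v = 0 := by
  by_cases hfg : (LinearMap.range g).FG
  · have hK : (LinearMap.ker g).CoFG := Submodule.range_fg_iff_ker_cofg.mp hfg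
    obtain ⟨v, hv, hP, h⟩ := aux_iso q (fun (_ : Unit) v => g v = 0 ∧ T v v v ≠ 0)
      (by
        intro _ W hW
        by_contra! hcon
        exact hV (aux_cubic_fin T hT1 hT2 (hW.inf hK) fun x hx => hcon x hx.1 hx.2))
      (by
        rintro _ v ⟨hgv, hTv⟩
        rw [hg, Submodule.mkQ_apply, Submodule.Quotient.mk_eq_zero] at hgv
        obtain ⟨W, hW, hz⟩ := aux_fin_vanish hgv
        refine ⟨(), W ⊓ LinearMap.ker (T v v), hW.inf (Submodule.CoFG.ker _), ?_⟩
        rintro w ⟨hwW, hw⟩ ⟨hgw, hTw⟩ x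
        have hgv' : g v = 0 := by
          rw [hg, Submodule.mkQ_apply, Submodule.Quotient.mk_eq_zero]; exact hgv
        have hz' : T v w w = 0 := hz w hwW
        simp only [map_add, map_smul, hgv', hgw, smul_zero, add_zero, true_and]
        have c1 := aux_cube T hT1 hT2 v w x hw
        have c2 := aux_cube T hT1 hT2 v w (-x) hw
        by_contra! hcon
        simp only [map_add, map_smul] at c1 c2
        rw [hcon.1] at c1
        rw [hcon.2] at c2
        have : 2 * T w w w = 0 := by linear_combination -c1 - c2 - 0 * hz'
        rcases mul_eq_zero.mp this with h | h
        · exact hk2 h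
        · exact hTw h) Finset.univ () W hW
    exact ⟨v, hv, Or.inr hP.2, fun i => h i (Finset.mem_univ i)⟩
  · obtain ⟨v, hv, hP, h⟩ := aux_iso q
      (fun (S : {S : Submodule k (QuadraticForm k V ⧸ FinStrength k V) // S.FG}) v => g v ∉ S.1)
      (by
        rintro ⟨S, hS⟩ W hW
        by_contra! hcon
        apply hfg
        have hle : W ≤ LinearMap.ker (S.mkQ.comp g) := fun x hx => by
          simpa using hcon x hx
        have h1 : (LinearMap.range (S.mkQ.comp g)).FG :=
          Submodule.range_fg_iff_ker_cofg.mpr (hW.of_le hle)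
        refine Submodule.fg_of_fg_map_of_fg_inf_ker S.mkQ ?_ ?_
        · rwa [← LinearMap.range_comp]
        · have : Module.Finite k S := Module.Finite.iff_fg.mpr hS
          exact Submodule.FG.of_le hS (by simp))
      (by
        rintro ⟨S, hS⟩ v hv
        refine ⟨⟨S ⊔ Submodule.span k {g v}, hS.sup (Submodule.fg_span_singleton _)⟩, ⊤,
          Submodule.CoFG.top, ?_⟩
        rintro w - hw x
        left
        intro h
        apply hw
        have : g w = g (w + x • v) + (-x) • g v := by simp
        rw [this]
        exact Submodule.add_mem_sup h
          (Submodule.smul_mem _ _ (Submodule.mem_span_singleton_self _)))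
      Finset.univ ⟨S, hS⟩ W hW
    exact ⟨v, hv, Or.inl hP, fun i => h i (Finset.mem_univ i)⟩

theorem aux_root {k : Type*} [Field k] [IsAlgClosed k] (A B C : k) (h : A ≠ 0 ∨ B ≠ 0) :
    ∃ x : k, A * x ^ 3 + B * x + C = 0 := by
  by_cases hA : A = 0
  · have hB : B ≠ 0 := by tauto
    exact ⟨-C / B, by rw [hA]; field_simp; ring⟩
  · obtain ⟨x, hx⟩ := IsAlgClosed.exists_root
      (Polynomial.C A * Polynomial.X ^ 3 + Polynomial.C 0 * Polynomial.X ^ 2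
        + Polynomial.C B * Polynomial.X + Polynomial.C C)
      (by rw [Polynomial.degree_cubic hA]; decide)
    exact ⟨x, by simpa [Polynomial.IsRoot] using hx⟩

/-- universality of strength, Corollary 2.4 of the paper. For a
non-degenerate cubic space `(V,T)`, quadratic forms `q₁,…,q_r` of infinite collective
strength, finite-strength quadratic forms `q'₁,…,q'_s` and linear forms `ℓ₁,…,ℓ_t`, any
prescribed values `a, b₁,…,b_r` can be attained simultaneously. -/
theorem exists_vector_with_prescribed_values
    {k V : Type*} [Field k] [IsAlgClosed k]
    (hk2 : (2 : k) ≠ 0) (hk3 : (3 : k) ≠ 0)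
    [AddCommGroup V] [Module k V]
    (T : V →ₗ[k] V →ₗ[k] V →ₗ[k] k)
    (hT1 : ∀ x y z, T x y z = T y x z) (hT2 : ∀ x y z, T x y z = T x z y)
    (hV : ¬ FiniteStrengthCubic k T)
    {r s t : ℕ} (q : Fin r → QuadraticForm k V)
    (hq : ∀ c : Fin r → k, c ≠ 0 → (∑ i, c i • q i) ∉ FinStrength k V)
    (q' : Fin s → QuadraticForm k V) (hq' : ∀ j, q' j ∈ FinStrength k V)
    (l : Fin t → V →ₗ[k] k) (a : k) (b : Fin r → k) :
    ∃ v : V, T v v v = a ∧ (∀ i, q i v = b i) ∧ (∀ j, q' j v = 0) ∧ ∀ j, l j v = 0 := by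
  classical
  -- restrict to a subspace of finite codimension
  obtain ⟨W, hW, hWq, hWl⟩ : ∃ W : Submodule k V, W.CoFG ∧ (∀ x ∈ W, ∀ j, q' j x = 0) ∧
      ∀ x ∈ W, ∀ j, l j x = 0 := by
    choose W hW hz using fun j => aux_fin_vanish (hq' j)
    refine ⟨(⨅ j, W j) ⊓ LinearMap.ker (LinearMap.pi l),
      (aux_iInf W hW).inf (Submodule.CoFG.ker _), fun x hx j => hz j x ?_, fun x hx j => ?_⟩
    · exact (Submodule.mem_iInf _).mp hx.1 j
    · exact congrFun hx.2 j
  let Q : V → QuadraticForm k V := fun v => LinearMap.BilinMap.toQuadraticMap (T v)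
  let g : V →ₗ[k] (QuadraticForm k V ⧸ FinStrength k V) :=
    (FinStrength k V).mkQ.comp ((LinearMap.BilinMap.toQuadraticMapLinearMap k k V).comp T)
  have hg : ∀ v, g v = (FinStrength k V).mkQ (Q v) := fun v => rfl
  let S := Submodule.span k (Set.range fun i => (FinStrength k V).mkQ (q i))
  have hS : S.FG := Submodule.fg_span (Set.finite_range _)
  obtain ⟨v, hvW, hgood, hqv⟩ := aux_good hk2 T hT1 hT2 hV q g hg S hS hW
  obtain ⟨W₁, hW₁, ho⟩ := aux_orth q (Submodule.fg_span_singleton (R := k) v)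
  have hW₂ : (W ⊓ (W₁ ⊓ LinearMap.ker (T v v))).CoFG :=
    hW.inf (hW₁.inf (Submodule.CoFG.ker _))
  obtain ⟨w, hw, hwb, hne⟩ : ∃ w ∈ W ⊓ (W₁ ⊓ LinearMap.ker (T v v)),
      (∀ i, q i w = b i) ∧ (T v v v ≠ 0 ∨ 3 * T v w w ≠ 0) := by
    by_cases hF : T v v v = 0
    · have hgS : g v ∉ S := by tauto
      obtain ⟨w, hw, h⟩ := aux_quadrics hk2 (fun o : Option (Fin r) => o.elim (Q v) q) (by
        intro c hc hmem
        rw [Fintype.sum_option] at hmem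
        simp only [Option.elim] at hmem
        by_cases hc0 : c none = 0
        · rw [hc0, zero_smul, zero_add] at hmem
          refine hq (fun i => c (some i)) (fun h => hc ?_) hmem
          ext o
          cases o with
          | none => exact hc0
          | some i => exact congrFun h i
        · apply hgS
          have h1 : (FinStrength k V).mkQ (c none • Q v + ∑ i, c (some i) • q i) = 0 := by
            rw [Submodule.mkQ_apply, Submodule.Quotient.mk_eq_zero]; exact hmem
          rw [map_add, map_smul, ← hg, map_sum] at h1
          have h2 : c none • g v ∈ S := by
            rw [eq_neg_of_add_eq_zero_left h1]
            refine S.neg_mem (S.sum_mem fun i _ => ?_)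
            rw [map_smul]
            exact S.smul_mem _ (Submodule.subset_span ⟨i, rfl⟩)
          exact (S.smul_mem_iff hc0).mp h2) hW₂ (fun o => o.elim 1 b)
      refine ⟨w, hw, fun i => h (some i), Or.inr ?_⟩
      have h1 : T v w w = 1 := h none
      rw [h1, mul_one]
      exact hk3
    · obtain ⟨w, hw, h⟩ := aux_quadrics hk2 q hq hW₂ b
      exact ⟨w, hw, h, Or.inl hF⟩
  obtain ⟨x, hx⟩ := aux_root (T v v v) (3 * T v w w) (T w w w - a) hne
  have hmem : w + x • v ∈ W := W.add_mem hw.1 (W.smul_mem _ hvW)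
  refine ⟨w + x • v, ?_, fun i => ?_, hWq _ hmem, hWl _ hmem⟩
  · rw [aux_cube T hT1 hT2 v w x hw.2.2]
    linear_combination hx
  · rw [aux_quad_smul_add, hwb, hqv, mul_zero, add_zero]
    rw [QuadraticMap.polar_comm]
    exact ho w hw.2.1 v (Submodule.mem_span_singleton_self _) i
end
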